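/- For every convex body K ⊂ ℝ², C(K) ≥ 108. Moreover C(Δ_{2,0}) = 108, where Δ_{2,0} := conv{(1,0),(0,1),(−1,−1)} ⊂ ℝ². -/

import Mathlib

open MeasureTheory Set

/-- Coordinates of a point of `ℝ²`. -/
noncomputable def coord2 (i : Fin 2) (q : ℝ × ℝ) : ℝ := if i = 0 then q.1 else q.2

/-- The barycenter coordinates of `A ⊆ ℝ²`. -/
noncomputable def bary2 (A : Set (ℝ × ℝ)) (i : Fin 2) : ℝ :=
  (∫ q in A, coord2 i q) / (volume A).toReal

/-- The covariance matrix of `A ⊆ ℝ²`. -/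
noncomputable def cov2 (A : Set (ℝ × ℝ)) : Matrix (Fin 2) (Fin 2) ℝ :=
  Matrix.of fun i j =>
    (∫ q in A, coord2 i q * coord2 j q) / (volume A).toReal - bary2 A i * bary2 A j

/-- The affine invariant `C(A) = |A|² / det Cov(A)`, the inverse `2n`-th power of the
isotropic constant. -/
noncomputable def isoC (A : Set (ℝ × ℝ)) : ℝ := (volume A).toReal ^ 2 / (cov2 A).det

/-- The simplex `Δ_{2,0} = conv{(1,0),(0,1),(-1,-1)} ⊆ ℝ²`. -/
noncomputable def simplexTwo : Set (ℝ × ℝ) :=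
  convexHull ℝ ({((1 : ℝ), (0 : ℝ)), ((0 : ℝ), (1 : ℝ)), ((-1 : ℝ), (-1 : ℝ))} : Set (ℝ × ℝ))

/-- The set between the graphs of `g` and `t` over `[a, b]`. -/
def graphRegion (a b : ℝ) (g t : ℝ → ℝ) : Set (ℝ × ℝ) :=
  {p | p.1 ∈ Icc a b ∧ g p.1 ≤ p.2 ∧ p.2 ≤ t p.1}

lemma isCompact_graphRegion {a b : ℝ} {g t : ℝ → ℝ} (hg : ContinuousOn g (Icc a b))
    (ht : ContinuousOn t (Icc a b)) : IsCompact (graphRegion a b g t) := by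
  obtain ⟨c, hc⟩ := (isCompact_Icc.image_of_continuousOn hg).bddBelow
  obtain ⟨d, hd⟩ := (isCompact_Icc.image_of_continuousOn ht).bddAbove
  have hclosed : IsClosed (graphRegion a b g t) := by
    have hS : IsClosed (Icc a b ×ˢ (univ : Set ℝ)) := isClosed_Icc.prod isClosed_univ
    have hm : MapsTo (Prod.fst : ℝ × ℝ → ℝ) (Icc a b ×ˢ (univ : Set ℝ)) (Icc a b) :=
      fun p hp => hp.1
    have h1 : IsClosed {p ∈ Icc a b ×ˢ (univ : Set ℝ) | g p.1 ≤ p.2} :=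
      hS.isClosed_le (hg.comp continuousOn_fst hm) continuousOn_snd
    have h2 : IsClosed {p ∈ Icc a b ×ˢ (univ : Set ℝ) | p.2 ≤ t p.1} :=
      hS.isClosed_le continuousOn_snd (ht.comp continuousOn_fst hm)
    convert h1.inter h2 using 1
    ext p
    simp only [graphRegion, mem_ofPred_eq, mem_inter_iff, mem_prod, mem_univ, and_true]
    tauto
  refine (isCompact_Icc.prod isCompact_Icc : IsCompact (Icc a b ×ˢ Icc c d)).of_isClosed_subset
    hclosed ?_
  rintro p ⟨h1, h2, h3⟩
  exact ⟨h1, (hc (mem_image_of_mem _ h1)).trans h2, h3.trans (hd (mem_image_of_mem _ h1))⟩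

lemma convex_graphRegion {a b : ℝ} {g t : ℝ → ℝ} (hg : ConvexOn ℝ (Icc a b) g)
    (ht : ConcaveOn ℝ (Icc a b) t) : Convex ℝ (graphRegion a b g t) := by
  rintro p ⟨hp1, hp2, hp3⟩ q ⟨hq1, hq2, hq3⟩ u v hu hv huv
  refine ⟨hg.1 hp1 hq1 hu hv huv, ?_, ?_⟩
  · refine (hg.2 hp1 hq1 hu hv huv).trans ?_
    simp only [smul_eq_mul, Prod.snd_add, Prod.smul_snd]
    gcongr
  · refine le_trans ?_ (ht.2 hp1 hq1 hu hv huv)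
    simp only [smul_eq_mul, Prod.snd_add, Prod.smul_snd]
    gcongr

lemma setIntegral_graphRegion {a b : ℝ} {g t : ℝ → ℝ} (hab : a ≤ b)
    (hg : ContinuousOn g (Icc a b)) (ht : ContinuousOn t (Icc a b))
    (hgt : ∀ x ∈ Icc a b, g x ≤ t x) {F : ℝ × ℝ → ℝ} (hF : Continuous F) :
    ∫ p in graphRegion a b g t, F p = ∫ x in a..b, ∫ y in g x..t x, F (x, y) := by
  have hK := isCompact_graphRegion hg ht
  have hInt : IntegrableOn F (graphRegion a b g t) := hF.continuousOn.integrableOn_compact hK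
  rw [← integral_indicator hK.measurableSet, Measure.volume_eq_prod, integral_prod _
    (by rw [← Measure.volume_eq_prod]; exact hInt.integrable_indicator hK.measurableSet),
    intervalIntegral.integral_of_le hab, ← integral_Icc_eq_integral_Ioc,
    ← integral_indicator measurableSet_Icc]
  congr 1
  ext x
  by_cases hx : x ∈ Icc a b
  · rw [indicator_of_mem hx, intervalIntegral.integral_of_le (hgt x hx),
      ← integral_Icc_eq_integral_Ioc, ← integral_indicator measurableSet_Icc]
    congr 1
    ext y
    by_cases hy : y ∈ Icc (g x) (t x)
    · rw [indicator_of_mem hy, indicator_of_mem (show (x, y) ∈ graphRegion a b g t from ⟨hx, hy⟩)]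
    · rw [indicator_of_notMem hy, indicator_of_notMem (fun h => hy h.2)]
  · rw [indicator_of_notMem hx, ← integral_zero ℝ ℝ (μ := volume)]
    congr 1
    ext y
    exact indicator_of_notMem (fun h => hx h.1) _

/-- A compact convex set is the region below the graph of a continuous concave function, up to
its lower boundary. -/
lemma exists_upper_boundary {K : Set (ℝ × ℝ)} (hK : IsCompact K) (hc : Convex ℝ K) {a b : ℝ}
    (hI : Prod.fst '' K = Icc a b) :
    ∃ t : ℝ → ℝ, ContinuousOn t (Icc a b) ∧ ConcaveOn ℝ (Icc a b) t ∧
      (∀ x ∈ Icc a b, (x, t x) ∈ K) ∧ ∀ p ∈ K, p.2 ≤ t p.1 := by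
  have hsec : ∀ x, IsCompact {y | (x, y) ∈ K} := fun x => by
    have : {y | (x, y) ∈ K} = Prod.snd '' (K ∩ Prod.fst ⁻¹' {x}) := by
      ext y
      constructor
      · intro h
        exact ⟨(x, y), ⟨h, rfl⟩, rfl⟩
      · rintro ⟨p, ⟨hp, hpx⟩, rfl⟩
        have : p.1 = x := hpx
        subst this
        exact hp
    rw [this]
    exact (hK.inter_right (isClosed_singleton.preimage continuous_fst)).image continuous_snd
  have hne : ∀ x ∈ Icc a b, {y | (x, y) ∈ K}.Nonempty := fun x hx => by
    rw [← hI] at hx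
    obtain ⟨p, hp, rfl⟩ := hx
    exact ⟨p.2, hp⟩
  set t : ℝ → ℝ := fun x => sSup {y | (x, y) ∈ K} with ht
  have hmem : ∀ x ∈ Icc a b, (x, t x) ∈ K := fun x hx => (hsec x).sSup_mem (hne x hx)
  have hle : ∀ p ∈ K, p.2 ≤ t p.1 := fun p hp => le_csSup (hsec p.1).bddAbove hp
  have hconc : ConcaveOn ℝ (Icc a b) t := by
    refine ⟨convex_Icc a b, fun x hx y hy u v hu hv huv => ?_⟩
    exact hle _ (hc (hmem x hx) (hmem y hy) hu hv huv)
  refine ⟨t, ?_, hconc, hmem, hle⟩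
  intro x₀ hx₀
  have hup : ∀ ε > 0, ∀ᶠ x in nhdsWithin x₀ (Icc a b), t x < t x₀ + ε := by
    intro ε hε
    have hC : IsCompact (Prod.fst '' (K ∩ {p | t x₀ + ε ≤ p.2})) :=
      (hK.inter_right (isClosed_le continuous_const continuous_snd)).image continuous_fst
    have hnot : x₀ ∈ (Prod.fst '' (K ∩ {p | t x₀ + ε ≤ p.2}))ᶜ := by
      rintro ⟨p, ⟨hp, hp2⟩, rfl⟩
      have := hle p hp
      simp only [mem_ofPred_eq] at hp2
      linarith
    filter_upwards [nhdsWithin_le_nhds (hC.isClosed.isOpen_compl.mem_nhds hnot),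
      self_mem_nhdsWithin] with x hx hxI
    by_contra! hcon
    exact hx ⟨(x, t x), ⟨hmem x hxI, hcon⟩, rfl⟩
  have hline : ∀ z ∈ Icc a b, ∀ ε > 0, ∀ᶠ x in nhds x₀, x ∈ uIcc x₀ z → t x₀ - ε < t x := by
    intro z hz ε hε
    rcases eq_or_ne x₀ z with rfl | hne
    · filter_upwards with x hx
      rw [uIcc_self, mem_singleton_iff] at hx
      rw [hx]; linarith
    have hcont : ContinuousAt (fun x => t x₀ + (x - x₀) / (z - x₀) * (t z - t x₀)) x₀ := by
      fun_prop
    have hev := hcont.eventually (lt_mem_nhds (show t x₀ - ε <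
      t x₀ + (x₀ - x₀) / (z - x₀) * (t z - t x₀) by simp; exact hε))
    filter_upwards [hev] with x hx hxz
    have hzx : z - x₀ ≠ 0 := sub_ne_zero.mpr hne.symm
    have h01 : 0 ≤ (x - x₀) / (z - x₀) ∧ (x - x₀) / (z - x₀) ≤ 1 := by
      rcases lt_or_gt_of_ne hne with h | h
      · rw [uIcc_of_le h.le] at hxz
        exact ⟨div_nonneg (by linarith [hxz.1]) (by linarith),
          (div_le_one (by linarith)).mpr (by linarith [hxz.2])⟩
      · rw [uIcc_of_ge h.le] at hxz
        exact ⟨div_nonneg_of_nonpos (by linarith [hxz.2]) (by linarith),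
          (div_le_one_of_neg (by linarith)).mpr (by linarith [hxz.1])⟩
    have := hconc.2 hx₀ hz (sub_nonneg.mpr h01.2) h01.1 (by ring)
    have hxeq : (1 - (x - x₀) / (z - x₀)) • x₀ + ((x - x₀) / (z - x₀)) • z = x := by
      simp only [smul_eq_mul]; field_simp; ring
    rw [hxeq] at this
    simp only [smul_eq_mul] at this
    linarith
  have hab : a ≤ b := hx₀.1.trans hx₀.2
  rw [ContinuousWithinAt, Metric.tendsto_nhds]
  intro ε hε
  filter_upwards [hup ε hε, nhdsWithin_le_nhds (hline a (left_mem_Icc.mpr hab) ε hε),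
    nhdsWithin_le_nhds (hline b (right_mem_Icc.mpr hab) ε hε), self_mem_nhdsWithin]
    with x h1 h2 h3 hx
  rw [Real.dist_eq, abs_lt]
  refine ⟨?_, by linarith⟩
  rcases le_total x x₀ with h | h
  · have := h2 (by rw [uIcc_of_ge hx₀.1]; exact ⟨hx.1, h⟩)
    linarith
  · have := h3 (by rw [uIcc_of_le hx₀.2]; exact ⟨h, hx.2⟩)
    linarith

lemma exists_eq_graphRegion_of_continuousOn {K : Set (ℝ × ℝ)} (hK : IsCompact K) (hc : Convex ℝ K)
    (hne : K.Nonempty) :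
    ∃ (a b : ℝ) (g t : ℝ → ℝ), a ≤ b ∧ ContinuousOn g (Icc a b) ∧ ContinuousOn t (Icc a b) ∧
      ConvexOn ℝ (Icc a b) g ∧ ConcaveOn ℝ (Icc a b) t ∧ (∀ x ∈ Icc a b, g x ≤ t x) ∧
      K = graphRegion a b g t := by
  have hI : IsCompact (Prod.fst '' K) := hK.image continuous_fst
  have hIne : (Prod.fst '' K).Nonempty := hne.image _
  have hIc : Convex ℝ (Prod.fst '' K) := hc.linear_image (LinearMap.fst ℝ ℝ ℝ)
  have hIcc := eq_Icc_of_connected_compact (hIc.isConnected hIne) hI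
  set a := sInf (Prod.fst '' K)
  set b := sSup (Prod.fst '' K)
  obtain ⟨t, ht1, ht2, ht3, ht4⟩ := exists_upper_boundary hK hc hIcc
  let r : (ℝ × ℝ) →ₗ[ℝ] ℝ × ℝ := (LinearMap.fst ℝ ℝ ℝ).prod (-LinearMap.snd ℝ ℝ ℝ)
  have hr : ∀ p, r p = (p.1, -p.2) := fun p => rfl
  have hKr : IsCompact (r '' K) := hK.image r.continuous_of_finiteDimensional
  have hIr : Prod.fst '' (r '' K) = Icc a b := by
    rw [← hIcc, image_image]
    rfl
  obtain ⟨s, hs1, hs2, hs3, hs4⟩ := exists_upper_boundary hKr (hc.linear_image r) hIr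
  have hs5 : ∀ x ∈ Icc a b, (x, -s x) ∈ K := fun x hx => by
    obtain ⟨p, hp, hpe⟩ := hs3 x hx
    rw [hr, Prod.mk.injEq] at hpe
    have : (x, -s x) = p := Prod.ext hpe.1.symm (by simp only [← hpe.2, neg_neg])
    rw [this]
    exact hp
  have hs6 : ∀ p ∈ K, -s p.1 ≤ p.2 := fun p hp => by
    have := hs4 _ (mem_image_of_mem r hp)
    rw [hr] at this
    simp only at this
    linarith
  refine ⟨a, b, fun x => -s x, t, ?_, hs1.neg, ht1, hs2.neg, ht2, fun x hx => ht4 _ (hs5 x hx), ?_⟩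
  · obtain ⟨x, hx⟩ := hIne
    rw [hIcc] at hx
    exact hx.1.trans hx.2
  · ext p
    constructor
    · intro hp
      exact ⟨hIcc ▸ mem_image_of_mem _ hp, hs6 p hp, ht4 p hp⟩
    · rintro ⟨h1, h2, h3⟩
      have hseg := hc.segment_subset (hs5 _ h1) (ht3 _ h1)
      rcases eq_or_lt_of_le (h2.trans h3) with h | h
      · have : p = (p.1, t p.1) := Prod.ext rfl (le_antisymm h3 (h ▸ h2))
        rw [this]
        exact ht3 _ h1
      · apply hseg
        have hd : 0 < t p.1 + s p.1 := by linarith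
        refine ⟨(t p.1 - p.2) / (t p.1 + s p.1), (p.2 + s p.1) / (t p.1 + s p.1),
          div_nonneg (by linarith) hd.le, div_nonneg (by linarith) hd.le, ?_, ?_⟩
        · field_simp; ring
        · ext
          · simp only [smul_eq_mul, Prod.smul_mk, Prod.mk_add_mk]; field_simp; ring
          · simp only [smul_eq_mul, Prod.smul_mk, Prod.mk_add_mk]; field_simp; ring

lemma exists_eq_graphRegion {K : Set (ℝ × ℝ)} (hK : IsCompact K) (hc : Convex ℝ K)
    (hne : K.Nonempty) :
    ∃ (a b : ℝ) (g t : ℝ → ℝ), a ≤ b ∧ Continuous g ∧ Continuous t ∧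
      ConvexOn ℝ (Icc a b) g ∧ ConcaveOn ℝ (Icc a b) t ∧ (∀ x ∈ Icc a b, g x ≤ t x) ∧
      K = graphRegion a b g t := by
  obtain ⟨a, b, g, t, hab, hg, ht, hgc, htc, hgt, rfl⟩ :=
    exists_eq_graphRegion_of_continuousOn hK hc hne
  have he : ∀ f : ℝ → ℝ, EqOn (IccExtend hab ((Icc a b).domRestrict f)) f (Icc a b) :=
    fun f x hx => by rw [IccExtend_of_mem hab _ hx, domRestrict_apply]
  refine ⟨a, b, _, _, hab, hg.domRestrict.Icc_extend', ht.domRestrict.Icc_extend',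
    hgc.congr (he g).symm, htc.congr (he t).symm, fun x hx => ?_, ?_⟩
  · rw [he g hx, he t hx]
    exact hgt x hx
  · ext p
    refine and_congr_right fun hp => ?_
    rw [he g hp, he t hp]

lemma integral_add_of_continuous {a b : ℝ} {φ ψ : ℝ → ℝ} (hφ : Continuous φ) (hψ : Continuous ψ) :
    ∫ x in a..b, (φ x + ψ x) = (∫ x in a..b, φ x) + ∫ x in a..b, ψ x :=
  intervalIntegral.integral_add (hφ.intervalIntegrable _ _) (hψ.intervalIntegrable _ _)

lemma integral_sub_of_continuous {a b : ℝ} {φ ψ : ℝ → ℝ} (hφ : Continuous φ) (hψ : Continuous ψ) :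
    ∫ x in a..b, (φ x - ψ x) = (∫ x in a..b, φ x) - ∫ x in a..b, ψ x :=
  intervalIntegral.integral_sub (hφ.intervalIntegrable _ _) (hψ.intervalIntegrable _ _)

lemma integral_nonpos_of_le {a b : ℝ} (hab : a ≤ b) {φ : ℝ → ℝ}
    (h : ∀ x ∈ Icc a b, φ x ≤ 0) : ∫ x in a..b, φ x ≤ 0 := by
  have := intervalIntegral.integral_nonneg hab (f := fun x => -φ x) (μ := volume)
    (fun x hx => by linarith [h x hx])
  rw [intervalIntegral.integral_neg] at this
  linarith

/-- A concave function lies above its chord inside and below it outside. -/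
lemma ConcaveOn.sub_chord {s : Set ℝ} {t : ℝ → ℝ} (ht : ConcaveOn ℝ s t) {p q : ℝ} (hp : p ∈ s)
    (hq : q ∈ s) (hpq : p < q) {x : ℝ} (hx : x ∈ s) :
    0 ≤ (t x - (t p + (t q - t p) / (q - p) * (x - p))) * ((x - p) * (q - x)) := by
  have hd : 0 < q - p := by linarith
  rcases lt_trichotomy x p with h | h | h
  · have := ht.slope_anti_adjacent hx hq h hpq
    rw [div_le_div_iff₀ hd (by linarith)] at this
    refine mul_nonneg_of_nonpos_of_nonpos ?_ (mul_nonpos_of_nonpos_of_nonneg (by linarith) (by linarith))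
    have e : t p + (t q - t p) / (q - p) * (x - p) = (t p * (q - p) + (t q - t p) * (x - p)) / (q - p) := by
      field_simp
    rw [e, sub_nonpos, le_div_iff₀ hd]
    nlinarith
  · subst h; simp
  · rcases lt_trichotomy x q with h' | h' | h'
    · have := ht.slope_anti_adjacent hp hq h h'
      rw [div_le_div_iff₀ (by linarith) (by linarith)] at this
      refine mul_nonneg ?_ (mul_nonneg (by linarith) (by linarith))
      have e : t p + (t q - t p) / (q - p) * (x - p) = (t p * (q - p) + (t q - t p) * (x - p)) / (q - p) := by
        field_simp
      rw [e, sub_nonneg, div_le_iff₀ hd]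
      nlinarith
    · subst h'; simp
    · have := ht.slope_anti_adjacent hp hx hpq h'
      rw [div_le_div_iff₀ (by linarith) hd] at this
      refine mul_nonneg_of_nonpos_of_nonpos ?_ (mul_nonpos_of_nonneg_of_nonpos (by linarith) (by linarith))
      have e : t p + (t q - t p) / (q - p) * (x - p) = (t p * (q - p) + (t q - t p) * (x - p)) / (q - p) := by
        field_simp
      rw [e, sub_nonpos, le_div_iff₀ hd]
      nlinarith

/-- A convex function orthogonal to affine functions correlates negatively with concave
functions. -/
lemma integral_convex_mul_concave_nonpos {a b : ℝ} (hab : a ≤ b) {ρ t f : ℝ → ℝ}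
    (hρ : Continuous ρ) (ht : Continuous t) (hf : Continuous f) (hρc : ConvexOn ℝ (Icc a b) ρ)
    (htc : ConcaveOn ℝ (Icc a b) t) (hf0 : ∀ x ∈ Icc a b, 0 ≤ f x)
    (h0 : ∫ x in a..b, ρ x * f x = 0) (h1 : ∫ x in a..b, x * (ρ x * f x) = 0) :
    ∫ x in a..b, ρ x * t x * f x ≤ 0 := by
  set S : Set ℝ := {x ∈ Icc a b | ρ x < 0} with hS
  by_cases hsub : S.Subsingleton
  · have hae : ∀ᵐ x ∂(volume.restrict (Ioc a b)), 0 ≤ ρ x * f x := by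
      rw [ae_restrict_iff' measurableSet_Ioc]
      filter_upwards [measure_eq_zero_iff_ae_notMem.mp (hsub.measure_zero volume)] with x hx hxI
      have hxI' := Ioc_subset_Icc_self hxI
      exact mul_nonneg (not_lt.mp fun h => hx ⟨hxI', h⟩) (hf0 x hxI')
    rw [intervalIntegral.integral_of_le hab] at h0 ⊢
    have hz := (integral_eq_zero_iff_of_nonneg_ae hae
      (((hρ.mul hf).intervalIntegrable a b).1)).mp h0
    refine (integral_eq_zero_of_ae ?_).le
    filter_upwards [hz] with x hx
    have : ρ x * f x = 0 := hx
    change ρ x * t x * f x = 0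
    linear_combination t x * this
  · rw [not_subsingleton_iff] at hsub
    have hSne := hsub.nonempty
    have hSI : S ⊆ Icc a b := fun x hx => hx.1
    have hbb : BddBelow S := bddBelow_Icc.mono hSI
    have hba : BddAbove S := bddAbove_Icc.mono hSI
    set p := sInf S
    set q := sSup S
    obtain ⟨x, hx, y, hy, hxy⟩ := hsub
    have hpq : p < q := by
      rcases lt_or_gt_of_ne hxy with h | h
      · exact (csInf_le hbb hx).trans_lt (h.trans_le (le_csSup hba hy))
      · exact (csInf_le hbb hy).trans_lt (h.trans_le (le_csSup hba hx))
    have hclos : closure S ⊆ {x ∈ Icc a b | ρ x ≤ 0} := by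
      refine closure_minimal (fun x hx => ⟨hx.1, hx.2.le⟩) ?_
      exact isClosed_Icc.inter (isClosed_le hρ continuous_const)
    have hp := hclos (csInf_mem_closure hSne hbb)
    have hq := hclos (csSup_mem_closure hSne hba)
    set c := (t q - t p) / (q - p)
    have hpt : ∀ x ∈ Icc a b, ρ x * f x * (t x - (t p + c * (x - p))) ≤ 0 := by
      intro x hx
      have hch := htc.sub_chord hp.1 hq.1 hpq hx
      have hfx := hf0 x hx
      rcases lt_or_ge x p with h | h
      · have hρx : 0 ≤ ρ x := not_lt.mp fun hh => absurd (csInf_le hbb ⟨hx, hh⟩) (not_le.mpr h)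
        refine mul_nonpos_of_nonneg_of_nonpos (mul_nonneg hρx hfx) ?_
        by_contra! hcon
        have : (x - p) * (q - x) < 0 := mul_neg_of_neg_of_pos (by linarith) (by linarith)
        linarith [mul_neg_of_pos_of_neg hcon this]
      · rcases lt_or_ge q x with h' | h'
        · have hρx : 0 ≤ ρ x := not_lt.mp fun hh => absurd (le_csSup hba ⟨hx, hh⟩) (not_le.mpr h')
          refine mul_nonpos_of_nonneg_of_nonpos (mul_nonneg hρx hfx) ?_
          by_contra! hcon
          have : (x - p) * (q - x) < 0 := mul_neg_of_pos_of_neg (by linarith) (by linarith)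
          linarith [mul_neg_of_pos_of_neg hcon this]
        · have hρx : ρ x ≤ 0 :=
            ((hρc.convex_le 0).ordConnected.out hp hq ⟨h, h'⟩).2
          refine mul_nonpos_of_nonpos_of_nonneg (mul_nonpos_of_nonpos_of_nonneg hρx hfx) ?_
          rcases eq_or_lt_of_le h with h2 | h2
          · rw [← h2]; simp
          · rcases eq_or_lt_of_le h' with h3 | h3
            · have : q - p ≠ 0 := by linarith
              rw [h3, div_mul_cancel₀ _ this]; simp
            · have : 0 < (x - p) * (q - x) := mul_pos (by linarith) (by linarith)
              by_contra! hcon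
              linarith [mul_neg_of_neg_of_pos hcon this]
    have hI := integral_nonpos_of_le hab hpt
    have he : (∫ x in a..b, ρ x * f x * (t x - (t p + c * (x - p)))) =
        (∫ x in a..b, ρ x * t x * f x) - (t p - c * p) * (∫ x in a..b, ρ x * f x)
          - c * ∫ x in a..b, x * (ρ x * f x) := by
      rw [← intervalIntegral.integral_const_mul, ← intervalIntegral.integral_const_mul,
        ← integral_sub_of_continuous (by fun_prop) (by fun_prop),
        ← integral_sub_of_continuous (by fun_prop) (by fun_prop)]
      congr 1
      ext x
      ring
    rw [he, h0, h1] at hI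
    linarith

lemma setIntegral_graphRegion_pow {a b : ℝ} {g t φ : ℝ → ℝ} (hab : a ≤ b) (hg : Continuous g)
    (ht : Continuous t) (hgt : ∀ x ∈ Icc a b, g x ≤ t x) (hφ : Continuous φ) (n : ℕ) :
    ∫ p in graphRegion a b g t, φ p.1 * p.2 ^ n =
      ∫ x in a..b, φ x * ((t x ^ (n + 1) - g x ^ (n + 1)) / (n + 1)) := by
  rw [setIntegral_graphRegion hab hg.continuousOn ht.continuousOn hgt (by fun_prop)]
  simp only [intervalIntegral.integral_const_mul, integral_pow]

lemma setIntegral_preimage_swap (K : Set (ℝ × ℝ)) (F : ℝ × ℝ → ℝ) :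
    ∫ p in Prod.swap ⁻¹' K, F p.swap = ∫ p in K, F p :=
  (Measure.measurePreserving_swap (μ := (volume : Measure ℝ)) (ν := volume)).setIntegral_preimage_emb
    (MeasurableEquiv.prodComm.measurableEmbedding) F K

/-- The determinant of the covariance matrix multiplied by the fourth power of the area. -/
noncomputable def covDet (K : Set (ℝ × ℝ)) : ℝ :=
  ((∫ _ in K, (1 : ℝ)) * (∫ p in K, p.1 ^ 2) - (∫ p in K, p.1) ^ 2) *
    ((∫ _ in K, (1 : ℝ)) * (∫ p in K, p.2 ^ 2) - (∫ p in K, p.2) ^ 2) -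
  ((∫ _ in K, (1 : ℝ)) * (∫ p in K, p.1 * p.2) - (∫ p in K, p.1) * ∫ p in K, p.2) ^ 2

lemma covDet_preimage_swap (K : Set (ℝ × ℝ)) : covDet (Prod.swap ⁻¹' K) = covDet K := by
  have h1 := setIntegral_preimage_swap K (fun _ => 1)
  have h2 := setIntegral_preimage_swap K (fun p => p.1)
  have h3 := setIntegral_preimage_swap K (fun p => p.2)
  have h4 := setIntegral_preimage_swap K (fun p => p.1 ^ 2)
  have h5 := setIntegral_preimage_swap K (fun p => p.2 ^ 2)
  have h6 := setIntegral_preimage_swap K (fun p => p.2 * p.1)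
  have h7 := setIntegral_preimage_swap K (fun p => p.1 * p.2)
  simp only [Prod.fst_swap, Prod.snd_swap] at h2 h3 h4 h5 h6 h7
  simp only [covDet, h1, h2, h3, h4, h5, h6]
  simp only [mul_comm (Prod.snd _)]
  ring

lemma setIntegral_sq_affine_pos {K : Set (ℝ × ℝ)} (hK : IsCompact K) (hi : (interior K).Nonempty)
    {α β : ℝ} (γ : ℝ) (h : α ≠ 0 ∨ β ≠ 0) : 0 < ∫ p in K, (α * p.1 + β * p.2 - γ) ^ 2 := by
  have hc : Continuous fun p : ℝ × ℝ => (α * p.1 + β * p.2 - γ) ^ 2 := by fun_prop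
  rw [setIntegral_pos_iff_support_of_nonneg_ae (Filter.Eventually.of_forall fun p => sq_nonneg _)
    (hc.continuousOn.integrableOn_compact hK)]
  have hsub : (Function.support (fun p : ℝ × ℝ => (α * p.1 + β * p.2 - γ) ^ 2) ∩ interior K) ⊆
      (Function.support fun p : ℝ × ℝ => (α * p.1 + β * p.2 - γ) ^ 2) ∩ K :=
    inter_subset_inter_right _ interior_subset
  refine lt_of_lt_of_le (IsOpen.measure_pos _ (hc.isOpen_support.inter isOpen_interior) ?_)
    (measure_mono hsub)
  obtain ⟨p, hp⟩ := hi
  have hcont : ContinuousAt (fun ε : ℝ => (p.1 + ε * α, p.2 + ε * β)) 0 := by fun_prop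
  have hev : ∀ᶠ ε in nhds (0 : ℝ), (p.1 + ε * α, p.2 + ε * β) ∈ interior K := by
    apply hcont.eventually_mem
    simpa using isOpen_interior.mem_nhds hp
  obtain ⟨ε, hε, hε0⟩ := ((hev.filter_mono nhdsWithin_le_nhds).and
    (self_mem_nhdsWithin (a := (0 : ℝ)) (s := Ioi 0))).exists
  have hε0 : 0 < ε := hε0
  by_cases h0 : α * p.1 + β * p.2 - γ = 0
  · refine ⟨_, ?_, hε⟩
    have hpos : 0 < α ^ 2 + β ^ 2 := by
      rcases h with h | h <;> positivity
    rw [Function.mem_support]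
    have : α * (p.1 + ε * α) + β * (p.2 + ε * β) - γ = ε * (α ^ 2 + β ^ 2) := by
      linear_combination h0
    simp only [this]
    positivity
  · exact ⟨p, by rw [Function.mem_support]; positivity, hp⟩

lemma setIntegral_sq_affine {K : Set (ℝ × ℝ)} (hK : IsCompact K) (α β γ : ℝ) :
    ∫ p in K, (α * p.1 + β * p.2 - γ) ^ 2 =
      α ^ 2 * (∫ p in K, p.1 ^ 2) + β ^ 2 * (∫ p in K, p.2 ^ 2) + γ ^ 2 * (∫ _ in K, (1 : ℝ)) +
      2 * α * β * (∫ p in K, p.1 * p.2) - 2 * α * γ * (∫ p in K, p.1)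
        - 2 * β * γ * ∫ p in K, p.2 := by
  have hInt : ∀ F : ℝ × ℝ → ℝ, Continuous F → Integrable F (volume.restrict K) := fun F hF =>
    hF.continuousOn.integrableOn_compact hK
  rw [← integral_const_mul, ← integral_const_mul, ← integral_const_mul, ← integral_const_mul,
    ← integral_const_mul, ← integral_const_mul,
    ← integral_add (hInt _ (by fun_prop)) (hInt _ (by fun_prop)),
    ← integral_add (hInt _ (by fun_prop)) (hInt _ (by fun_prop)),
    ← integral_add (hInt _ (by fun_prop)) (hInt _ (by fun_prop)),
    ← integral_sub (hInt _ (by fun_prop)) (hInt _ (by fun_prop)),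
    ← integral_sub (hInt _ (by fun_prop)) (hInt _ (by fun_prop))]
  congr 1
  ext p
  ring

lemma covDet_pos {K : Set (ℝ × ℝ)} (hK : IsCompact K) (hi : (interior K).Nonempty) :
    0 < (∫ _ in K, (1 : ℝ)) ∧
    0 < (∫ _ in K, (1 : ℝ)) * (∫ p in K, p.1 ^ 2) - (∫ p in K, p.1) ^ 2 ∧ 0 < covDet K := by
  have hpos : ∀ α β γ : ℝ, α ≠ 0 ∨ β ≠ 0 → _ := fun α β γ h =>
    (setIntegral_sq_affine hK α β γ) ▸ setIntegral_sq_affine_pos hK hi γ h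
  have hV : 0 < ∫ _ in K, (1 : ℝ) := by
    rw [integral_pos_iff_support_of_nonneg (fun _ => zero_le_one)
      (continuous_const.continuousOn.integrableOn_compact hK)]
    have : Function.support (fun _ : ℝ × ℝ => (1 : ℝ)) = univ := by
      ext; simp
    rw [this, Measure.restrict_apply_univ]
    exact Measure.measure_pos_of_nonempty_interior _ hi
  unfold covDet
  set V := ∫ _ in K, (1 : ℝ)
  set X := ∫ p in K, p.1
  set Y := ∫ p in K, p.2
  set XX := ∫ p in K, p.1 ^ 2
  set YY := ∫ p in K, p.2 ^ 2
  set XY := ∫ p in K, p.1 * p.2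
  have hA : 0 < V * XX - X ^ 2 := by
    have := mul_pos hV (hpos 1 0 (X / V) (Or.inl one_ne_zero))
    have e : V * (1 ^ 2 * XX + 0 ^ 2 * YY + (X / V) ^ 2 * V + 2 * 1 * 0 * XY - 2 * 1 * (X / V) * X
        - 2 * 0 * (X / V) * Y) = V * XX - X ^ 2 := by
      field_simp; ring
    rwa [e] at this
  refine ⟨hV, hA, ?_⟩
  set A := V * XX - X ^ 2 with hAd
  set B := V * XY - X * Y with hB
  have := mul_pos hV (hpos (-B) A ((-B * X + A * Y) / V) (Or.inr hA.ne'))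
  have e : V * ((-B) ^ 2 * XX + A ^ 2 * YY + ((-B * X + A * Y) / V) ^ 2 * V + 2 * (-B) * A * XY
      - 2 * (-B) * ((-B * X + A * Y) / V) * X - 2 * A * ((-B * X + A * Y) / V) * Y) =
      B ^ 2 * (V * XX - X ^ 2) + A ^ 2 * (V * YY - Y ^ 2) - 2 * A * B * (V * XY - X * Y) := by
    field_simp; ring
  rw [e, ← hAd, ← hB] at this
  have e2 : B ^ 2 * A + A ^ 2 * (V * YY - Y ^ 2) - 2 * A * B * B =
    A * (A * (V * YY - Y ^ 2) - B ^ 2) := by ring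
  rw [e2] at this
  exact pos_of_mul_pos_right this hA.le

lemma convexOn_affine {s : Set ℝ} (hs : Convex ℝ s) (α β : ℝ) :
    ConvexOn ℝ s fun x => α * x + β :=
  ⟨hs, fun x _ y _ u v _ _ huv => by
    simp only [smul_eq_mul]
    exact le_of_eq (by linear_combination (-β) * huv)⟩

/-- Sliding the vertical chords of a planar convex body down to the horizontal axis does not
decrease the covariance determinant. -/
lemma covDet_le_slide {a b : ℝ} {g t : ℝ → ℝ} (hab : a ≤ b) (hg : Continuous g)
    (ht : Continuous t) (hgc : ConvexOn ℝ (Icc a b) g) (htc : ConcaveOn ℝ (Icc a b) t)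
    (hgt : ∀ x ∈ Icc a b, g x ≤ t x) (hV : 0 < ∫ _ in graphRegion a b g t, (1 : ℝ))
    (hpos : 0 < (∫ _ in graphRegion a b g t, (1 : ℝ)) * (∫ p in graphRegion a b g t, p.1 ^ 2) -
      (∫ p in graphRegion a b g t, p.1) ^ 2) :
    covDet (graphRegion a b g t) ≤ covDet (graphRegion a b (fun _ => 0) (fun x => t x - g x)) := by
  have key : ∀ g t : ℝ → ℝ, Continuous g → Continuous t → (∀ x ∈ Icc a b, g x ≤ t x) →
      (∫ _ in graphRegion a b g t, (1 : ℝ)) = (∫ x in a..b, (t x - g x)) ∧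
      (∫ p in graphRegion a b g t, p.1) = (∫ x in a..b, x * (t x - g x)) ∧
      (∫ p in graphRegion a b g t, p.1 ^ 2) = (∫ x in a..b, x ^ 2 * (t x - g x)) ∧
      (∫ p in graphRegion a b g t, p.2) = (∫ x in a..b, (t x ^ 2 - g x ^ 2) / 2) ∧
      (∫ p in graphRegion a b g t, p.1 * p.2) = (∫ x in a..b, x * ((t x ^ 2 - g x ^ 2) / 2)) ∧
      (∫ p in graphRegion a b g t, p.2 ^ 2) = (∫ x in a..b, (t x ^ 3 - g x ^ 3) / 3) := by
    intro g t hg ht hgt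
    have h := fun (φ : ℝ → ℝ) (hφ : Continuous φ) n =>
      setIntegral_graphRegion_pow hab hg ht hgt hφ n
    refine ⟨?_, ?_, ?_, ?_, ?_, ?_⟩
    · simpa using h (fun _ => 1) (by fun_prop) 0
    · simpa using h (fun x => x) (by fun_prop) 0
    · simpa using h (fun x => x ^ 2) (by fun_prop) 0
    · have := h (fun _ => 1) (by fun_prop) 1
      norm_num at this ⊢
      exact this
    · have := h (fun x => x) (by fun_prop) 1
      norm_num at this ⊢
      exact this
    · have := h (fun _ => 1) (by fun_prop) 2
      norm_num at this ⊢
      exact this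
  obtain ⟨k1, k2, k3, k4, k5, k6⟩ := key g t hg ht hgt
  obtain ⟨l1, l2, l3, l4, l5, l6⟩ := key (fun _ => 0) (fun x => t x - g x) continuous_const
    (ht.sub hg) (fun x hx => sub_nonneg.mpr (hgt x hx))
  simp only [covDet, k1, k2, k3, k4, k5, k6, l1, l2, l3, l4, l5, l6] at *
  simp only [sub_zero, ne_eq, OfNat.ofNat_ne_zero, not_false_eq_true, zero_pow]
  set V := ∫ x in a..b, (t x - g x) with hVd
  set X := ∫ x in a..b, x * (t x - g x) with hXd
  set XX := ∫ x in a..b, x ^ 2 * (t x - g x) with hXXd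
  set G := ∫ x in a..b, g x * (t x - g x) with hGd
  set T := ∫ x in a..b, t x * (t x - g x) with hTd
  set XG := ∫ x in a..b, x * (g x * (t x - g x)) with hXGd
  set XT := ∫ x in a..b, x * (t x * (t x - g x)) with hXTd
  set TG := ∫ x in a..b, t x * g x * (t x - g x) with hTGd
  set Q := ∫ x in a..b, (t x - g x) ^ 3 / 3 with hQd
  have e1 : ∫ x in a..b, (t x ^ 2 - g x ^ 2) / 2 = (T + G) / 2 := by
    rw [hTd, hGd, ← integral_add_of_continuous (by fun_prop) (by fun_prop),
      ← intervalIntegral.integral_div]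
    congr 1; ext x; ring
  have e2 : ∫ x in a..b, x * ((t x ^ 2 - g x ^ 2) / 2) = (XT + XG) / 2 := by
    rw [hXTd, hXGd, ← integral_add_of_continuous (by fun_prop) (by fun_prop),
      ← intervalIntegral.integral_div]
    congr 1; ext x; ring
  have e3 : ∫ x in a..b, (t x ^ 3 - g x ^ 3) / 3 = TG + Q := by
    rw [hTGd, hQd, ← integral_add_of_continuous (by fun_prop) (by fun_prop)]
    congr 1; ext x; ring
  have e4 : ∫ x in a..b, (t x - g x) ^ 2 / 2 = (T - G) / 2 := by
    rw [hTd, hGd, ← integral_sub_of_continuous (by fun_prop) (by fun_prop),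
      ← intervalIntegral.integral_div]
    congr 1; ext x; ring
  have e5 : ∫ x in a..b, x * ((t x - g x) ^ 2 / 2) = (XT - XG) / 2 := by
    rw [hXTd, hXGd, ← integral_sub_of_continuous (by fun_prop) (by fun_prop),
      ← intervalIntegral.integral_div]
    congr 1; ext x; ring
  rw [e1, e2, e3, e4, e5]
  set D := V * XX - X ^ 2 with hD
  obtain ⟨α, hα⟩ : ∃ α, α = (G * XX - XG * X) / D := ⟨_, rfl⟩
  obtain ⟨β, hβ⟩ : ∃ β, β = (XG * V - G * X) / D := ⟨_, rfl⟩
  rw [eq_div_iff hpos.ne'] at hα hβ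
  have hn1 : G - α * V - β * X = 0 := by
    apply mul_left_cancel₀ hpos.ne'
    rw [hD] at *
    linear_combination (-V) * hα - X * hβ
  have hn2 : XG - α * X - β * XX = 0 := by
    apply mul_left_cancel₀ hpos.ne'
    rw [hD] at *
    linear_combination (-X) * hα - XX * hβ
  have hmain := integral_convex_mul_concave_nonpos (ρ := fun x => g x + (-β * x + -α))
    (t := t) (f := fun x => t x - g x) hab (by fun_prop) ht (by fun_prop)
    (hgc.add (convexOn_affine (convex_Icc a b) (-β) (-α))) htc
    (fun x hx => sub_nonneg.mpr (hgt x hx))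
    (by
      rw [← hn1, hGd, hVd, hXd, ← intervalIntegral.integral_const_mul,
        ← intervalIntegral.integral_const_mul,
        ← integral_sub_of_continuous (by fun_prop) (by fun_prop),
        ← integral_sub_of_continuous (by fun_prop) (by fun_prop)]
      congr 1; ext x; ring)
    (by
      rw [← hn2, hXGd, hXXd, hXd, ← intervalIntegral.integral_const_mul,
        ← intervalIntegral.integral_const_mul,
        ← integral_sub_of_continuous (by fun_prop) (by fun_prop),
        ← integral_sub_of_continuous (by fun_prop) (by fun_prop)]
      congr 1; ext x; ring)
  have e6 : (∫ x in a..b, (g x + (-β * x + -α)) * t x * (t x - g x)) = TG - α * T - β * XT := by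
    rw [hTGd, hTd, hXTd, ← intervalIntegral.integral_const_mul,
        ← intervalIntegral.integral_const_mul,
        ← integral_sub_of_continuous (by fun_prop) (by fun_prop),
        ← integral_sub_of_continuous (by fun_prop) (by fun_prop)]
    congr 1; ext x; ring
  rw [e6] at hmain
  have hm := mul_nonpos_of_nonneg_of_nonpos hV.le
    (mul_nonpos_of_nonneg_of_nonpos hpos.le hmain)
  have e7 : D * (TG - α * T - β * XT) = D * TG - (G * XX - XG * X) * T - (XG * V - G * X) * XT := by
    linear_combination (-T) * hα - XT * hβ
  rw [e7] at hm
  rw [hD] at *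
  nlinarith

/-- Horizontal slices of the region under the graph of a concave function. -/
lemma exists_slices {a b : ℝ} {f : ℝ → ℝ} (hab : a ≤ b) (hf : Continuous f)
    (hfc : ConcaveOn ℝ (Icc a b) f) (hf0 : ∀ x ∈ Icc a b, 0 ≤ f x) :
    ∃ (M : ℝ) (g t : ℝ → ℝ), 0 ≤ M ∧ Continuous g ∧ Continuous t ∧ ConvexOn ℝ (Icc 0 M) g ∧
      ConcaveOn ℝ (Icc 0 M) t ∧ (∀ x ∈ Icc 0 M, g x ≤ t x) ∧ MonotoneOn g (Icc 0 M) ∧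
      AntitoneOn t (Icc 0 M) ∧ g 0 = a ∧ t 0 = b ∧
      Prod.swap ⁻¹' graphRegion a b (fun _ => 0) f = graphRegion 0 M g t := by
  have hK : IsCompact (Prod.swap ⁻¹' graphRegion a b (fun _ => 0) f) :=
    (Homeomorph.prodComm ℝ ℝ).isCompact_preimage.mpr
      (isCompact_graphRegion continuousOn_const hf.continuousOn)
  have hc : Convex ℝ (Prod.swap ⁻¹' graphRegion a b (fun _ => 0) f) :=
    (convex_graphRegion (convexOn_const 0 (convex_Icc a b)) hfc).linear_preimage
      ((LinearMap.snd ℝ ℝ ℝ).prod (LinearMap.fst ℝ ℝ ℝ))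
  have hmem : ∀ x y, (x, y) ∈ Prod.swap ⁻¹' graphRegion a b (fun _ => 0) f ↔
      y ∈ Icc a b ∧ 0 ≤ x ∧ x ≤ f y := fun x y => Iff.rfl
  have h0a : ((0 : ℝ), a) ∈ Prod.swap ⁻¹' graphRegion a b (fun _ => 0) f :=
    (hmem _ _).mpr ⟨left_mem_Icc.mpr hab, le_rfl, hf0 a (left_mem_Icc.mpr hab)⟩
  have h0b : ((0 : ℝ), b) ∈ Prod.swap ⁻¹' graphRegion a b (fun _ => 0) f :=
    (hmem _ _).mpr ⟨right_mem_Icc.mpr hab, le_rfl, hf0 b (right_mem_Icc.mpr hab)⟩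
  obtain ⟨m, M, g, t, hmM, hg, ht, hgc, htc, hgt, he⟩ := exists_eq_graphRegion hK hc ⟨_, h0a⟩
  rw [he] at hmem h0a h0b
  have hlo : ∀ x ∈ Icc m M, (x, g x) ∈ graphRegion m M g t := fun x hx => ⟨hx, le_rfl, hgt x hx⟩
  have hhi : ∀ x ∈ Icc m M, (x, t x) ∈ graphRegion m M g t := fun x hx => ⟨hx, hgt x hx, le_rfl⟩
  have hm : m = 0 := le_antisymm h0a.1.1 ((hmem _ _).mp (hlo m (left_mem_Icc.mpr hmM))).2.1
  subst hm
  have hz : (0 : ℝ) ∈ Icc 0 M := left_mem_Icc.mpr hmM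
  refine ⟨M, g, t, hmM, hg, ht, hgc, htc, hgt, fun x hx y hy hxy => ?_, fun x hx y hy hxy => ?_,
    ?_, ?_, he⟩
  · obtain ⟨h1, h2, h3⟩ := (hmem _ _).mp (hlo y hy)
    exact ((hmem x (g y)).mpr ⟨h1, hx.1, hxy.trans h3⟩).2.1
  · obtain ⟨h1, h2, h3⟩ := (hmem _ _).mp (hhi y hy)
    exact ((hmem x (t y)).mpr ⟨h1, hx.1, hxy.trans h3⟩).2.2
  · exact le_antisymm h0a.2.1 ((hmem _ _).mp (hlo 0 hz)).1.1
  · exact le_antisymm ((hmem _ _).mp (hhi 0 hz)).1.2 h0b.2.2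

lemma setIntegral_snd_pow_eq_of_swap {a b c d : ℝ} {g t u v : ℝ → ℝ} (hab : a ≤ b) (hcd : c ≤ d)
    (hg : Continuous g) (ht : Continuous t) (hgt : ∀ x ∈ Icc a b, g x ≤ t x)
    (hu : Continuous u) (hv : Continuous v) (huv : ∀ x ∈ Icc c d, u x ≤ v x)
    (he : Prod.swap ⁻¹' graphRegion a b g t = graphRegion c d u v) (n : ℕ) :
    ∫ x in a..b, (t x ^ (n + 1) - g x ^ (n + 1)) / (n + 1) = ∫ y in c..d, y ^ n * (v y - u y) := by
  have h1 := setIntegral_graphRegion_pow hab hg ht hgt (continuous_const (y := (1 : ℝ))) n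
  have h2 := setIntegral_graphRegion_pow hcd hu hv huv (continuous_pow n) 0
  have h3 := setIntegral_preimage_swap (graphRegion a b g t) (fun p => p.2 ^ n)
  simp only [one_mul] at h1
  simp only [Prod.snd_swap] at h3
  simp only [zero_add, pow_zero, mul_one, pow_one, CharP.cast_eq_zero, div_one] at h2
  rw [← h1, ← h3, he, h2]

/-- The decreasing rearrangement of a concave function on the unit interval. -/
lemma exists_antitone_rearrangement {h : ℝ → ℝ} (hh : Continuous h)
    (hc : ConcaveOn ℝ (Icc 0 1) h) (h0 : ∀ x ∈ Icc (0 : ℝ) 1, 0 ≤ h x) :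
    ∃ k : ℝ → ℝ, Continuous k ∧ ConcaveOn ℝ (Icc 0 1) k ∧ AntitoneOn k (Icc 0 1) ∧
      (∀ x ∈ Icc (0 : ℝ) 1, 0 ≤ k x) ∧
      ∀ n : ℕ, ∫ x in (0 : ℝ)..1, k x ^ (n + 1) = ∫ x in (0 : ℝ)..1, h x ^ (n + 1) := by
  obtain ⟨M, g, t, hM, hg, ht, hgc, htc, hgt, hgm, hta, hg0, ht1, he⟩ :=
    exists_slices zero_le_one hh hc h0
  have hfa : AntitoneOn (fun x => t x - g x) (Icc 0 M) := fun x hx y hy hxy =>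
    sub_le_sub (hta hx hy hxy) (hgm hx hy hxy)
  have hf0 : ∀ x ∈ Icc 0 M, 0 ≤ t x - g x := fun x hx => sub_nonneg.mpr (hgt x hx)
  obtain ⟨N, u, v, hN, hu, hv, huc, hvc, huv, -, hva, -, -, he2⟩ :=
    exists_slices (f := fun x => t x - g x) hM (ht.sub hg) (htc.sub hgc) hf0
  have hmem : ∀ x y, (x, y) ∈ graphRegion 0 N u v ↔ y ∈ Icc 0 M ∧ 0 ≤ x ∧ x ≤ t y - g y :=
    fun x y => by rw [← he2]; exact Iff.rfl
  have hM0 : (0 : ℝ) ∈ Icc 0 M := left_mem_Icc.mpr hM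
  have hbase : ∀ x ∈ Icc (0 : ℝ) 1, (x, (0 : ℝ)) ∈ graphRegion 0 N u v := fun x hx =>
    (hmem _ _).mpr ⟨hM0, hx.1, by rw [hg0, ht1, sub_zero]; exact hx.2⟩
  have hN1 : N = 1 := by
    refine le_antisymm ?_ (hbase 1 (right_mem_Icc.mpr zero_le_one)).1.2
    have hNN : N ∈ Icc 0 N := right_mem_Icc.mpr hN
    obtain ⟨h1, h2, h3⟩ := (hmem N (u N)).mp ⟨hNN, le_rfl, huv N hNN⟩
    have := hfa hM0 h1 h1.1
    simp only [hg0, ht1] at this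
    linarith
  subst hN1
  have hu0 : ∀ x ∈ Icc (0 : ℝ) 1, u x = 0 := fun x hx =>
    le_antisymm (hbase x hx).2.1 ((hmem x (u x)).mp ⟨hx, le_rfl, huv x hx⟩).1.1
  refine ⟨v, hv, hvc, hva, fun x hx => hu0 x hx ▸ huv x hx, fun n => ?_⟩
  have k1 := setIntegral_snd_pow_eq_of_swap zero_le_one hM continuous_const hh h0 hg ht hgt he n
  have k2 := setIntegral_preimage_swap (graphRegion 0 M (fun _ => 0) (fun x => t x - g x))
    (fun p => p.1 ^ n)
  have k3 := setIntegral_graphRegion_pow zero_le_one hu hv huv (continuous_const (y := (1 : ℝ))) n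
  have k4 := setIntegral_graphRegion_pow (t := fun x => t x - g x) hM continuous_const
    (ht.sub hg) hf0 (continuous_pow n) 0
  simp only [zero_add, pow_zero, mul_one, pow_one, CharP.cast_eq_zero, div_one, sub_zero] at k4
  simp only [one_mul] at k3
  simp only [Prod.fst_swap] at k2
  rw [he2, k3, k4, ← k1] at k2
  have k5 : ∫ x in (0 : ℝ)..1, (v x ^ (n + 1) - u x ^ (n + 1)) / (n + 1) =
      ∫ x in (0 : ℝ)..1, (v x ^ (n + 1) - 0 ^ (n + 1)) / (n + 1) := by
    refine intervalIntegral.integral_congr fun x hx => ?_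
    rw [uIcc_of_le zero_le_one] at hx
    simp only [hu0 x hx]
  rw [k5] at k2
  simp only [ne_eq, Nat.add_eq_zero_iff, one_ne_zero, and_false, not_false_eq_true, zero_pow,
    sub_zero, intervalIntegral.integral_div] at k2
  have : (n : ℝ) + 1 ≠ 0 := by positivity
  exact (div_left_inj' this).mp k2

lemma integral_cubic (a b c₀ c₁ c₂ c₃ : ℝ) :
    ∫ x in a..b, (c₀ + c₁ * x + c₂ * x ^ 2 + c₃ * x ^ 3) =
      c₀ * (b - a) + c₁ * ((b ^ 2 - a ^ 2) / 2) + c₂ * ((b ^ 3 - a ^ 3) / 3) +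
        c₃ * ((b ^ 4 - a ^ 4) / 4) := by
  rw [integral_add_of_continuous (by fun_prop) (by fun_prop),
    integral_add_of_continuous (by fun_prop) (by fun_prop),
    integral_add_of_continuous (by fun_prop) (by fun_prop)]
  have h1 : ∫ x in a..b, c₁ * x = c₁ * ((b ^ 2 - a ^ 2) / 2) := by
    rw [intervalIntegral.integral_const_mul, integral_id]
  simp only [intervalIntegral.integral_const_mul, integral_pow, h1,
    intervalIntegral.integral_const, smul_eq_mul]
  push_cast
  ring

lemma exists_zero_of_integral_mul_eq_zero {D w : ℝ → ℝ} (hD : Continuous D) (hw : Continuous w)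
    (hw0 : ∀ x ∈ Ioo (0 : ℝ) 1, 0 < w x) (h : ∫ x in (0 : ℝ)..1, D x * w x = 0) :
    ∃ x ∈ Ioo (0 : ℝ) 1, D x = 0 := by
  by_contra! hcon
  have hpos : ∀ E : ℝ → ℝ, Continuous E → (∀ x ∈ Ioo (0 : ℝ) 1, E x ≠ 0) → 0 < E (1 / 2) →
      0 < ∫ x in (0 : ℝ)..1, E x * w x := by
    intro E hE hne h2
    refine intervalIntegral.intervalIntegral_pos_of_pos_on
      ((hE.mul hw).intervalIntegrable _ _) (fun x hx => mul_pos ?_ (hw0 x hx)) one_pos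
    by_contra! hx0
    obtain ⟨y, hy, hy0⟩ := isPreconnected_Ioo.intermediate_value hx
      (show (1 / 2 : ℝ) ∈ Ioo (0 : ℝ) 1 by norm_num) hE.continuousOn ⟨hx0, h2.le⟩
    exact hne y hy hy0
  rcases lt_or_gt_of_ne (hcon (1 / 2) (by norm_num)) with h2 | h2
  · have := hpos (fun x => -D x) hD.neg (fun x hx => neg_ne_zero.mpr (hcon x hx)) (by linarith)
    simp only [neg_mul, intervalIntegral.integral_neg, h] at this
    linarith
  · linarith [hpos D hD hcon h2]

lemma ConcaveOn.mul_le_mul_of_zero {h : ℝ → ℝ} (hc : ConcaveOn ℝ (Icc 0 1) h)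
    (h0 : 0 ≤ h 0) {x y : ℝ} (hx : 0 ≤ x) (hxy : x ≤ y)
    (hy : y ≤ 1) : h y * x ≤ h x * y := by
  rcases eq_or_lt_of_le (hx.trans hxy) with e | hy0
  · have : x = y := by linarith
    rw [this]
  · have := hc.2 (left_mem_Icc.mpr zero_le_one) (show y ∈ Icc (0 : ℝ) 1 from ⟨hy0.le, hy⟩)
      (sub_nonneg.mpr ((div_le_one hy0).mpr hxy)) (div_nonneg hx hy0.le) (by ring)
    simp only [smul_eq_mul, mul_zero, zero_add, div_mul_cancel₀ _ hy0.ne'] at this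
    have h2 : 0 ≤ (1 - x / y) * h 0 :=
      mul_nonneg (sub_nonneg.mpr ((div_le_one hy0).mpr hxy)) h0
    have h3 : x / y * h y ≤ h x := by linarith
    calc h y * x = (x / y * h y) * y := by field_simp
      _ ≤ h x * y := by gcongr

lemma ConcaveOn.mul_le_mul_of_one {h : ℝ → ℝ} (hc : ConcaveOn ℝ (Icc 0 1) h)
    (h1 : 0 ≤ h 1) {x y : ℝ} (hx : 0 ≤ x) (hxy : x ≤ y)
    (hy : y ≤ 1) : h x * (1 - y) ≤ h y * (1 - x) := by
  have hc' : ConcaveOn ℝ (Icc 0 1) fun x => h (1 - x) := by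
    refine ⟨convex_Icc _ _, fun x hx y hy u v hu hv huv => ?_⟩
    have := hc.2 (show 1 - x ∈ Icc (0 : ℝ) 1 from ⟨by linarith [hx.2], by linarith [hx.1]⟩)
      (show 1 - y ∈ Icc (0 : ℝ) 1 from ⟨by linarith [hy.2], by linarith [hy.1]⟩) hu hv huv
    simp only [smul_eq_mul] at this ⊢
    convert this using 2
    linear_combination -huv
  simpa using hc'.mul_le_mul_of_zero (by simpa using h1) (sub_nonneg.mpr hy)
    (sub_le_sub_left hxy 1) (by linarith)

/-- Berwald-type comparison of the first three power integrals. -/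
lemma integral_cube_le {h : ℝ → ℝ} (hh : Continuous h) (hc : ConcaveOn ℝ (Icc 0 1) h)
    (h0 : ∀ x ∈ Icc (0 : ℝ) 1, 0 ≤ h x) :
    ∫ x in (0 : ℝ)..1, h x ^ 3 ≤
      3 / 2 * (∫ x in (0 : ℝ)..1, h x) * ∫ x in (0 : ℝ)..1, h x ^ 2 := by
  obtain ⟨k, hk, hkc, hka, hk0, hki⟩ := exists_antitone_rearrangement hh hc h0
  have e1 := hki 0
  have e2 := hki 1
  have e3 := hki 2
  norm_num at e1 e2 e3
  rw [← e1, ← e2, ← e3]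
  set H := ∫ x in (0 : ℝ)..1, k x with hH
  set P := ∫ x in (0 : ℝ)..1, k x ^ 2 with hP
  set W := ∫ x in (0 : ℝ)..1, k x ^ 3 with hW
  set R := ∫ x in (0 : ℝ)..1, (1 - x) * k x ^ 2 with hR
  have h1 : 0 ≤ k 1 := hk0 1 (right_mem_Icc.mpr zero_le_one)
  have hHnn : 0 ≤ H := intervalIntegral.integral_nonneg zero_le_one hk0
  clear_value H
  have hz : ∫ x in (0 : ℝ)..1, (k x - 2 * H * (1 - x)) * 1 = 0 := by
    have e : ∀ x, (k x - 2 * H * (1 - x)) * 1 =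
        k x - (2 * H + (-2 * H) * x + 0 * x ^ 2 + 0 * x ^ 3) := fun x => by ring
    simp only [e]
    rw [integral_sub_of_continuous hk (by fun_prop), integral_cubic, ← hH]
    ring
  obtain ⟨x₀, hx₀, hx₀e⟩ := exists_zero_of_integral_mul_eq_zero (by fun_prop)
    continuous_const (fun _ _ => one_pos) hz
  have hI1 : ∫ x in (0 : ℝ)..1, (k x - 2 * H * (1 - x)) * (k x ^ 2 - k x₀ ^ 2) ≤ 0 := by
    refine integral_nonpos_of_le zero_le_one fun x hx => ?_
    have hx1 : 0 < 1 - x₀ := by linarith [hx₀.2]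
    have hkx := hk0 x hx
    have hkx₀ := hk0 x₀ ⟨hx₀.1.le, hx₀.2.le⟩
    rcases le_total x x₀ with hle | hle
    · refine mul_nonpos_of_nonpos_of_nonneg ?_ ?_
      · have := hkc.mul_le_mul_of_one h1 hx.1 hle hx₀.2.le
        have : (k x - 2 * H * (1 - x)) * (1 - x₀) ≤ 0 := by
          have e : k x₀ = 2 * H * (1 - x₀) := by linarith
          rw [e] at this
          linarith
        exact nonpos_of_mul_nonpos_left this hx1
      · exact sub_nonneg.mpr (pow_le_pow_left₀ hkx₀ (hka hx ⟨hx₀.1.le, hx₀.2.le⟩ hle) 2)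
    · refine mul_nonpos_of_nonneg_of_nonpos ?_ ?_
      · have := hkc.mul_le_mul_of_one h1 hx₀.1.le hle hx.2
        have : 0 ≤ (k x - 2 * H * (1 - x)) * (1 - x₀) := by
          have e : k x₀ = 2 * H * (1 - x₀) := by linarith
          rw [e] at this
          linarith
        exact nonneg_of_mul_nonneg_left this hx1
      · exact sub_nonpos.mpr (pow_le_pow_left₀ hkx (hka ⟨hx₀.1.le, hx₀.2.le⟩ hx hle) 2)
  have hE1 : ∫ x in (0 : ℝ)..1, (k x - 2 * H * (1 - x)) * (k x ^ 2 - k x₀ ^ 2) =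
      W - 2 * H * R - k x₀ ^ 2 * ∫ x in (0 : ℝ)..1, (k x - 2 * H * (1 - x)) * 1 := by
    rw [hW, hR, ← intervalIntegral.integral_const_mul, ← intervalIntegral.integral_const_mul,
      ← integral_sub_of_continuous (by fun_prop) (by fun_prop),
      ← integral_sub_of_continuous (by fun_prop) (by fun_prop)]
    congr 1; ext x; ring
  have hI2 : ∫ x in (0 : ℝ)..1, (k x ^ 2 - (k (1 / 4) * (1 - x) / (3 / 4)) ^ 2) * (1 / 4 - x) ≤
      0 := by
    refine integral_nonpos_of_le zero_le_one fun x hx => ?_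
    have hkx := hk0 x hx
    have hκ := hk0 (1 / 4) (by norm_num)
    have hnn : 0 ≤ k (1 / 4) * (1 - x) / (3 / 4) := by
      have : 0 ≤ 1 - x := by linarith [hx.2]
      positivity
    rcases le_total x (1 / 4) with hle | hle
    · refine mul_nonpos_of_nonpos_of_nonneg (sub_nonpos.mpr (pow_le_pow_left₀ hkx ?_ 2))
        (by linarith)
      rw [le_div_iff₀ (by norm_num)]
      have := hkc.mul_le_mul_of_one h1 hx.1 hle (by norm_num)
      linarith
    · refine mul_nonpos_of_nonneg_of_nonpos (sub_nonneg.mpr (pow_le_pow_left₀ hnn ?_ 2))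
        (by linarith)
      rw [div_le_iff₀ (by norm_num)]
      have := hkc.mul_le_mul_of_one h1 (by norm_num) hle hx.2
      linarith
  have hE2 : ∫ x in (0 : ℝ)..1, (k x ^ 2 - (k (1 / 4) * (1 - x) / (3 / 4)) ^ 2) * (1 / 4 - x) =
      R - 3 / 4 * P - k (1 / 4) ^ 2 * (16 / 9) *
        ∫ x in (0 : ℝ)..1, (1 / 4 + (-3 / 2) * x + 9 / 4 * x ^ 2 + (-1) * x ^ 3) := by
    rw [hR, hP, ← intervalIntegral.integral_const_mul, ← intervalIntegral.integral_const_mul,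
      ← integral_sub_of_continuous (by fun_prop) (by fun_prop),
      ← integral_sub_of_continuous (by fun_prop) (by fun_prop)]
    congr 1; ext x; ring
  rw [integral_cubic] at hE2
  norm_num at hE2
  rw [hE1, hz] at hI1
  have hI3 : R ≤ 3 / 4 * P := by
    have := hI2
    norm_num at this
    linarith
  nlinarith [mul_le_mul_of_nonneg_left hI3 hHnn]

/-- A concave function below the diagonal is compared with the triangular profile of the same
integral. -/
lemma le_first_moment {h : ℝ → ℝ} (hh : Continuous h) (hc : ConcaveOn ℝ (Icc 0 1) h)
    (h0 : ∀ x ∈ Icc (0 : ℝ) 1, 0 ≤ h x) (hx : ∀ x ∈ Icc (0 : ℝ) 1, h x ≤ x) :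
    (∫ x in (0 : ℝ)..1, h x) + 2 * (∫ x in (0 : ℝ)..1, h x) ^ 2 ≤
      3 * ∫ x in (0 : ℝ)..1, x * h x := by
  have hHnn : 0 ≤ ∫ x in (0 : ℝ)..1, h x := intervalIntegral.integral_nonneg zero_le_one h0
  have hbnn : 0 ≤ ∫ x in (0 : ℝ)..1, x * h x :=
    intervalIntegral.integral_nonneg zero_le_one fun x hx => mul_nonneg hx.1 (h0 x hx)
  have hdiff : ∀ c₀ c₁ : ℝ, ∫ x in (0 : ℝ)..1, (c₀ + c₁ * x) * (x - h x) =
      c₀ * (1 / 2 - ∫ x in (0 : ℝ)..1, h x) + c₁ * (1 / 3 - ∫ x in (0 : ℝ)..1, x * h x) := by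
    intro c₀ c₁
    have e : ∀ x, (c₀ + c₁ * x) * (x - h x) =
      (0 + c₀ * x + c₁ * x ^ 2 + 0 * x ^ 3) - (c₀ * h x + c₁ * (x * h x)) := fun x => by ring
    simp only [e]
    rw [integral_sub_of_continuous (by fun_prop) (by fun_prop), integral_cubic,
      integral_add_of_continuous (by fun_prop) (by fun_prop),
      intervalIntegral.integral_const_mul, intervalIntegral.integral_const_mul]
    ring
  have hH2 : ∫ x in (0 : ℝ)..1, h x ≤ 1 / 2 := by
    have := hdiff 1 0
    have h2 : 0 ≤ ∫ x in (0 : ℝ)..1, (1 + 0 * x) * (x - h x) :=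
      intervalIntegral.integral_nonneg zero_le_one fun x hxI => by
        have := hx x hxI
        nlinarith
    linarith
  set H := ∫ x in (0 : ℝ)..1, h x with hH
  set b := ∫ x in (0 : ℝ)..1, x * h x with hb
  clear_value H b
  rcases eq_or_lt_of_le hHnn with hz | hHpos
  · rw [← hz]; linarith
  rcases eq_or_lt_of_le hH2 with hhalf | hHlt
  · have h2 : 0 ≤ ∫ x in (0 : ℝ)..1, (1 + (-1) * x) * (x - h x) :=
      intervalIntegral.integral_nonneg zero_le_one fun x hxI => by
        have := hx x hxI
        exact mul_nonneg (by linarith [hxI.2]) (by linarith)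
    rw [hdiff] at h2
    rw [hhalf] at h2 ⊢
    linarith
  set s := 2 * H with hs
  have hs1 : 0 < 1 - s := by linarith
  set L := s / (1 - s) with hL
  have hLpos : 0 < L := div_pos (by linarith) hs1
  have hLs : L * (1 - s) = s := div_mul_cancel₀ _ hs1.ne'
  clear_value L
  set T : ℝ → ℝ := fun x => min x (L * (1 - x)) with hT
  have hTc : Continuous T := by fun_prop
  have hTl : ∀ x ≤ s, T x = x := fun x hx => min_eq_left (by nlinarith)
  have hTr : ∀ x, s ≤ x → T x = L * (1 - x) := fun x hx => min_eq_right (by nlinarith)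
  have hTint : ∀ c₀ c₁ : ℝ, ∫ x in (0 : ℝ)..1, (c₀ + c₁ * x) * T x =
      c₀ * (s / 2) + c₁ * (s * (1 + s) / 6) := by
    intro c₀ c₁
    have hcont : Continuous fun x => (c₀ + c₁ * x) * T x := by fun_prop
    rw [← intervalIntegral.integral_add_adjacent_intervals (hcont.intervalIntegrable 0 s)
      (hcont.intervalIntegrable s 1)]
    have e1 : ∫ x in (0 : ℝ)..s, (c₀ + c₁ * x) * T x =
        ∫ x in (0 : ℝ)..s, (0 + c₀ * x + c₁ * x ^ 2 + 0 * x ^ 3) := by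
      refine intervalIntegral.integral_congr fun x hxI => ?_
      rw [uIcc_of_le (by linarith)] at hxI
      simp only [hTl x hxI.2]
      ring
    have e2 : ∫ x in s..1, (c₀ + c₁ * x) * T x =
        ∫ x in s..1, (L * c₀ + L * (c₁ - c₀) * x + (-L * c₁) * x ^ 2 + 0 * x ^ 3) := by
      refine intervalIntegral.integral_congr fun x hxI => ?_
      rw [uIcc_of_le (by linarith)] at hxI
      simp only [hTr x hxI.1]
      ring
    rw [e1, e2, integral_cubic, integral_cubic]
    have hLe : L = s / (1 - s) := by field_simp; linarith
    rw [hLe]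
    field_simp
    ring
  have hhint : ∀ c₀ c₁ : ℝ, ∫ x in (0 : ℝ)..1, (c₀ + c₁ * x) * h x = c₀ * H + c₁ * b := by
    intro c₀ c₁
    have e : ∀ x, (c₀ + c₁ * x) * h x = c₀ * h x + c₁ * (x * h x) := fun x => by ring
    simp only [e]
    rw [integral_add_of_continuous (by fun_prop) (by fun_prop),
      intervalIntegral.integral_const_mul, intervalIntegral.integral_const_mul, hH, hb]
  have hcross : ∀ c₀ c₁ : ℝ, c₁ = 1 → (∀ x ∈ Icc (0 : ℝ) 1, (c₀ + c₁ * x) * T x ≤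
      (c₀ + c₁ * x) * h x) → H + 2 * H ^ 2 ≤ 3 * b := by
    intro c₀ c₁ hc1 hle
    have hcT : Continuous fun x => (c₀ + c₁ * x) * T x := by fun_prop
    have hch : Continuous fun x => (c₀ + c₁ * x) * h x := by fun_prop
    have := intervalIntegral.integral_mono_on zero_le_one
      (hcT.intervalIntegrable (μ := volume) 0 1) (hch.intervalIntegrable 0 1) hle
    rw [hTint, hhint, hc1] at this
    nlinarith
  have h00 : h 0 = 0 := le_antisymm (hx 0 (by simp)) (h0 0 (by simp))
  have h11 : 0 ≤ h 1 := h0 1 (by simp)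
  by_cases hall : ∀ x ∈ Icc (0 : ℝ) 1, h x ≤ L * (1 - x)
  · refine hcross (-1) 1 rfl fun x hxI => ?_
    have : h x ≤ T x := le_min (hx x hxI) (hall x hxI)
    nlinarith [hxI.2]
  · push Not at hall
    obtain ⟨x₁, hx₁, hx₁'⟩ := hall
    have hcont : ContinuousOn (fun x => h x - L * (1 - x)) (Icc 0 x₁) := by fun_prop
    obtain ⟨x₀, hx₀, hx₀e⟩ := intermediate_value_Ioo hx₁.1 hcont
      (show (0 : ℝ) ∈ Ioo _ _ from ⟨by simp only [h00]; linarith, by linarith⟩)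
    have hx₀1 : 0 < 1 - x₀ := by linarith [hx₀.2, hx₁.2]
    simp only at hx₀e
    have hx₀e' : h x₀ = L * (1 - x₀) := by linarith
    refine hcross (-x₀) 1 rfl fun x hxI => ?_
    rcases le_total x x₀ with hle | hle
    · have h1 := hc.mul_le_mul_of_one h11 hxI.1 hle (by linarith)
      rw [hx₀e'] at h1
      have h2 : h x ≤ L * (1 - x) := le_of_mul_le_mul_right (by linarith) hx₀1
      have : h x ≤ T x := le_min (hx x hxI) h2
      nlinarith
    · have h1 := hc.mul_le_mul_of_one h11 hx₀.1.le hle hxI.2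
      rw [hx₀e'] at h1
      have h2 : L * (1 - x) ≤ h x := le_of_mul_le_mul_right (by linarith) hx₀1
      have : T x ≤ h x := (min_le_right _ _).trans h2
      nlinarith

/-- Two-point Gaussian quadrature against a convex function. -/
lemma quadrature_moment_le {h : ℝ → ℝ} (hh : Continuous h) (hc : ConcaveOn ℝ (Icc 0 1) h)
    (hx : ∀ x ∈ Icc (0 : ℝ) 1, h x ≤ x) {l : ℝ} (hl0 : 0 ≤ l) (hl1 : l < 1) :
    0 ≤ 6 * ((∫ x in (0 : ℝ)..1, x * h x) - ∫ x in (0 : ℝ)..1, x ^ 2 * h x)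
      - (1 + 4 * l + l ^ 2) * (∫ x in (0 : ℝ)..1, h x) + 6 * l * (∫ x in (0 : ℝ)..1, x * h x)
      + l ^ 2 / 2 := by
  set w : ℝ := (1 - l) / (2 * √3) with hw
  have h3 : (√3 : ℝ) ^ 2 = 3 := Real.sq_sqrt (by norm_num)
  have h3pos : (0 : ℝ) < √3 := by positivity
  have hwpos : 0 < w := div_pos (by linarith) (by positivity)
  have hw2 : w ^ 2 = (1 - l) ^ 2 / 12 := by
    rw [hw, div_pow, mul_pow, h3]; norm_num
  have hwlt : w < (1 - l) / 2 := by
    have : w ^ 2 < ((1 - l) / 2) ^ 2 := by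
      rw [hw2]
      have : 0 < (1 - l) ^ 2 := by have : 0 < 1 - l := by linarith
                                   positivity
      nlinarith
    exact lt_of_pow_lt_pow_left₀ 2 (by linarith) this
  clear_value w
  set Q : ℝ → ℝ := fun x => -6 * x ^ 2 + 6 * (1 + l) * x - (1 + 4 * l + l ^ 2) with hQ
  have hQc : Continuous Q := by fun_prop
  have hQf : ∀ x, Q x = 6 * ((x - ((1 + l) / 2 - w)) * (((1 + l) / 2 + w) - x)) := fun x => by
    simp only [hQ]
    linear_combination (-6) * hw2
  have hp : (1 + l) / 2 - w ∈ Icc (0 : ℝ) 1 := ⟨by linarith, by linarith⟩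
  have hq : (1 + l) / 2 + w ∈ Icc (0 : ℝ) 1 := ⟨by linarith, by linarith⟩
  have hzc : ConcaveOn ℝ (Icc 0 1) fun x => h x - (1 * x + 0) :=
    hc.sub (convexOn_affine (convex_Icc 0 1) 1 0)
  set p := (1 + l) / 2 - w with hpd
  set q := (1 + l) / 2 + w with hqd
  have hch := fun x (hx : x ∈ Icc (0 : ℝ) 1) => hzc.sub_chord hp hq (by linarith) hx
  set A := h p - (1 * p + 0)
  set B := (h q - (1 * q + 0) - A) / (q - p)
  have hzQ : Continuous fun x => (h x - x) * Q x := by fun_prop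
  have hI1 : 0 ≤ ∫ x in (0 : ℝ)..l, (h x - x) * Q x := by
    refine intervalIntegral.integral_nonneg hl0 fun x hxI => ?_
    have h1 := hx x ⟨hxI.1, by linarith [hxI.2]⟩
    refine mul_nonneg_of_nonpos_of_nonpos (by linarith) ?_
    rw [hQf]
    have : (x - p) * (q - x) ≤ 0 :=
      mul_nonpos_of_nonpos_of_nonneg (by linarith [hxI.2]) (by linarith [hxI.2])
    linarith
  have hI2 : 0 ≤ ∫ x in l..1, (h x - x - (A + B * (x - p))) * Q x := by
    refine intervalIntegral.integral_nonneg hl1.le fun x hxI => ?_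
    have h1 := hch x ⟨by linarith [hxI.1], hxI.2⟩
    rw [hQf]
    linarith
  have hI3 : ∫ x in l..1, (h x - x - (A + B * (x - p))) * Q x =
      (∫ x in l..1, (h x - x) * Q x) - ∫ x in l..1, (-(A - B * p) * (1 + 4 * l + l ^ 2) +
        ((A - B * p) * (6 * (1 + l)) - B * (1 + 4 * l + l ^ 2)) * x +
        ((A - B * p) * (-6) + B * (6 * (1 + l))) * x ^ 2 + (-6 * B) * x ^ 3) := by
    rw [← integral_sub_of_continuous (by fun_prop) (by fun_prop)]
    congr 1; ext x; simp only [hQ]; ring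
  rw [integral_cubic] at hI3
  have hI4 : 0 ≤ ∫ x in (0 : ℝ)..1, (h x - x) * Q x := by
    rw [← intervalIntegral.integral_add_adjacent_intervals (hzQ.intervalIntegrable 0 l)
      (hzQ.intervalIntegrable l 1)]
    have : (∫ x in l..1, (h x - x) * Q x) = ∫ x in l..1, (h x - x - (A + B * (x - p))) * Q x := by
      rw [hI3]; ring
    rw [this]
    exact add_nonneg hI1 hI2
  have hI5 : ∫ x in (0 : ℝ)..1, (h x - x) * Q x =
      -6 * (∫ x in (0 : ℝ)..1, x ^ 2 * h x) + 6 * (1 + l) * (∫ x in (0 : ℝ)..1, x * h x)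
      - (1 + 4 * l + l ^ 2) * (∫ x in (0 : ℝ)..1, h x)
      - ∫ x in (0 : ℝ)..1, (0 + (-(1 + 4 * l + l ^ 2)) * x + 6 * (1 + l) * x ^ 2 + (-6) * x ^ 3) := by
    rw [← intervalIntegral.integral_const_mul, ← intervalIntegral.integral_const_mul,
      ← intervalIntegral.integral_const_mul,
      ← integral_add_of_continuous (by fun_prop) (by fun_prop),
      ← integral_sub_of_continuous (by fun_prop) (by fun_prop),
      ← integral_sub_of_continuous (by fun_prop) (by fun_prop)]
    congr 1; ext x; simp only [hQ]; ring
  rw [hI5, integral_cubic] at hI4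
  linarith

lemma integral_sq_mul_le {h : ℝ → ℝ} (hh : Continuous h) (hc : ConcaveOn ℝ (Icc 0 1) h)
    (h0 : ∀ x ∈ Icc (0 : ℝ) 1, 0 ≤ h x) :
    ∫ x in (0 : ℝ)..1, (1 - x) * h x ^ 2 ≤
      12 * (∫ x in (0 : ℝ)..1, x * (1 - x) * h x) * ∫ x in (0 : ℝ)..1, (1 - x) ^ 2 * h x := by
  set d := ∫ x in (0 : ℝ)..1, x * (1 - x) * h x with hd
  set g := ∫ x in (0 : ℝ)..1, (1 - x) ^ 2 * h x with hg
  clear_value d g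
  have hz : ∫ x in (0 : ℝ)..1, (h x - 12 * d * (1 - x)) * (x * (1 - x)) = 0 := by
    have e : ∀ x, (h x - 12 * d * (1 - x)) * (x * (1 - x)) = x * (1 - x) * h x -
      (0 + 12 * d * x + (-24 * d) * x ^ 2 + 12 * d * x ^ 3) := fun x => by ring
    simp only [e]
    rw [integral_sub_of_continuous (by fun_prop) (by fun_prop), integral_cubic, ← hd]
    ring
  obtain ⟨x₀, hx₀, hx₀e⟩ := exists_zero_of_integral_mul_eq_zero (by fun_prop)
    (by fun_prop) (fun x hx => mul_pos hx.1 (sub_pos.mpr hx.2)) hz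
  have hx₀e' : h x₀ = 12 * d * (1 - x₀) := by linarith
  set r := h x₀ / x₀ with hr
  have hrx : r * x₀ = h x₀ := div_mul_cancel₀ _ hx₀.1.ne'
  clear_value r
  have hx₀1 : 0 < 1 - x₀ := by linarith [hx₀.2]
  have h00 : 0 ≤ h 0 := h0 0 (by simp)
  have h11 : 0 ≤ h 1 := h0 1 (by simp)
  have hI : ∫ x in (0 : ℝ)..1, (h x - 12 * d * (1 - x)) * (h x - r * x) * (1 - x) ≤ 0 := by
    refine integral_nonpos_of_le zero_le_one fun x hxI => ?_
    refine mul_nonpos_of_nonpos_of_nonneg ?_ (by linarith [hxI.2])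
    rcases le_total x x₀ with hle | hle
    · have h1 := hc.mul_le_mul_of_one h11 hxI.1 hle hx₀.2.le
      have h2 := hc.mul_le_mul_of_zero h00 hxI.1 hle hx₀.2.le
      rw [hx₀e'] at h1
      rw [← hrx] at h2
      have h1' : h x ≤ 12 * d * (1 - x) := le_of_mul_le_mul_right (by linarith) hx₀1
      have h2' : r * x ≤ h x := le_of_mul_le_mul_right (by linarith) hx₀.1
      exact mul_nonpos_of_nonpos_of_nonneg (by linarith) (by linarith)
    · have h1 := hc.mul_le_mul_of_one h11 hx₀.1.le hle hxI.2
      have h2 := hc.mul_le_mul_of_zero h00 hx₀.1.le hle hxI.2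
      rw [hx₀e'] at h1
      rw [← hrx] at h2
      have h1' : 12 * d * (1 - x) ≤ h x := le_of_mul_le_mul_right (by linarith) hx₀1
      have h2' : h x ≤ r * x := le_of_mul_le_mul_right (by linarith) hx₀.1
      exact mul_nonpos_of_nonneg_of_nonpos (by linarith) (by linarith)
  have hE : ∫ x in (0 : ℝ)..1, (h x - 12 * d * (1 - x)) * (h x - r * x) * (1 - x) =
      (∫ x in (0 : ℝ)..1, (1 - x) * h x ^ 2) - 12 * d * g -
        r * ∫ x in (0 : ℝ)..1, (h x - 12 * d * (1 - x)) * (x * (1 - x)) := by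
    rw [hg, ← intervalIntegral.integral_const_mul, ← intervalIntegral.integral_const_mul,
      ← integral_sub_of_continuous (by fun_prop) (by fun_prop),
      ← integral_sub_of_continuous (by fun_prop) (by fun_prop)]
    congr 1; ext x; ring
  rw [hE, hz] at hI
  linarith

/-- The polynomial inequality behind the deficit estimate. -/
lemma deficit_poly_nonpos {H b d : ℝ} (hH0 : 0 ≤ H) (hH : H ≤ 1 / 2) (hb : H + 2 * H ^ 2 ≤ 3 * b)
    (hd : H ≤ 6 * d)
    (hl : 0 ≤ 6 * d - (1 + 4 * (4 * H / 3) + (4 * H / 3) ^ 2) * H + 6 * (4 * H / 3) * b +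
      (4 * H / 3) ^ 2 / 2) :
    -d + H / 6 + 6 * d * (H - b - d) - H ^ 2 / 3 + H ^ 3 / 3 ≤ 0 := by
  obtain ⟨N, rfl⟩ : ∃ N, H = N / 2 := ⟨2 * H, by ring⟩
  obtain ⟨E, rfl⟩ : ∃ E, d = (N + E) / 12 := ⟨12 * d - N, by ring⟩
  obtain ⟨μ, rfl⟩ : ∃ μ, b = (N + μ) / 6 := ⟨6 * b - N, by ring⟩
  have hE : 0 ≤ E := by linarith
  have hμ : N ^ 2 ≤ μ := by linarith
  have hN0 : 0 ≤ N := by linarith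
  have hN1 : N ≤ 1 := by linarith
  have hEG : 2 / 3 * N * (N - 2 * μ + N ^ 2) ≤ E := by
    have : 0 ≤ N ^ 2 * (1 - N) := mul_nonneg (sq_nonneg N) (by linarith)
    linarith
  have hfac : 3 / 4 ≤ 1 - N + μ := by linarith [sq_nonneg (N - 1 / 2)]
  have := mul_le_mul_of_nonneg_left hfac hE
  linarith [sq_nonneg E]

/-- Moments of the region under the graph of a normalized decreasing concave function. -/
lemma sum_moments_le {u : ℝ → ℝ} (hu : Continuous u) (hc : ConcaveOn ℝ (Icc 0 1) u)
    (ha : AntitoneOn u (Icc 0 1)) (hu0 : u 0 = 1) (hu1 : 0 ≤ u 1) :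
    (∫ x in (0 : ℝ)..1, u x) * ((∫ x in (0 : ℝ)..1, x ^ 2 * u x) +
        (∫ x in (0 : ℝ)..1, u x ^ 3 / 3) + ∫ x in (0 : ℝ)..1, x * (u x ^ 2 / 2)) -
      ((∫ x in (0 : ℝ)..1, x * u x) ^ 2 + (∫ x in (0 : ℝ)..1, u x ^ 2 / 2) ^ 2 +
        (∫ x in (0 : ℝ)..1, x * u x) * ∫ x in (0 : ℝ)..1, u x ^ 2 / 2) ≤
      (∫ x in (0 : ℝ)..1, u x) ^ 3 / 6 := by
  obtain ⟨h, hh⟩ : ∃ h : ℝ → ℝ, h = fun x => u x - ((-1) * x + 1) := ⟨_, rfl⟩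
  have huh : ∀ x, u x = h x + (1 - x) := fun x => by rw [hh]; ring
  have hhc : Continuous h := by rw [hh]; fun_prop
  have hcc : ConcaveOn ℝ (Icc 0 1) h := by
    rw [hh]
    exact hc.sub (convexOn_affine (convex_Icc 0 1) _ _)
  have h0 : ∀ x ∈ Icc (0 : ℝ) 1, 0 ≤ h x := fun x hx => by
    have := hc.mul_le_mul_of_one hu1 le_rfl hx.1 hx.2
    rw [hu0, huh] at this
    linarith
  have hx : ∀ x ∈ Icc (0 : ℝ) 1, h x ≤ x := fun x hx => by
    have := ha (left_mem_Icc.mpr zero_le_one) hx hx.1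
    rw [hu0, huh] at this
    linarith
  have hB := le_first_moment hhc hcc h0 hx
  have hE0 := quadrature_moment_le hhc hcc hx le_rfl one_pos
  have hE := fun l => quadrature_moment_le hhc hcc hx (l := l)
  have hU := integral_sq_mul_le hhc hcc h0
  have hW := integral_cube_le hhc hcc h0
  have hHnn : 0 ≤ ∫ x in (0 : ℝ)..1, h x := intervalIntegral.integral_nonneg zero_le_one h0
  have hHle : (∫ x in (0 : ℝ)..1, h x) ≤ 1 / 2 := by
    have := intervalIntegral.integral_mono_on zero_le_one
      (hhc.intervalIntegrable (μ := volume) 0 1) (continuous_id.intervalIntegrable 0 1) hx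
    simpa using this
  obtain ⟨H, hH⟩ : ∃ H, H = ∫ x in (0 : ℝ)..1, h x := ⟨_, rfl⟩
  obtain ⟨b, hb⟩ : ∃ b, b = ∫ x in (0 : ℝ)..1, x * h x := ⟨_, rfl⟩
  obtain ⟨c, hc⟩ : ∃ c, c = ∫ x in (0 : ℝ)..1, x ^ 2 * h x := ⟨_, rfl⟩
  obtain ⟨P, hP⟩ : ∃ P, P = ∫ x in (0 : ℝ)..1, h x ^ 2 := ⟨_, rfl⟩
  obtain ⟨V, hV⟩ : ∃ V, V = ∫ x in (0 : ℝ)..1, x * h x ^ 2 := ⟨_, rfl⟩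
  obtain ⟨W, hWd⟩ : ∃ W, W = ∫ x in (0 : ℝ)..1, h x ^ 3 := ⟨_, rfl⟩
  have m1 : ∫ x in (0 : ℝ)..1, (1 - x) * h x ^ 2 = P - V := by
    rw [hP, hV, ← integral_sub_of_continuous (by fun_prop) (by fun_prop)]
    congr 1; ext x; ring
  have m2 : ∫ x in (0 : ℝ)..1, x * (1 - x) * h x = b - c := by
    rw [hb, hc, ← integral_sub_of_continuous (by fun_prop) (by fun_prop)]
    congr 1; ext x; ring
  have m3 : ∫ x in (0 : ℝ)..1, (1 - x) ^ 2 * h x = H - 2 * b + c := by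
    rw [hH, hb, hc, ← intervalIntegral.integral_const_mul,
      ← integral_sub_of_continuous (by fun_prop) (by fun_prop),
      ← integral_add_of_continuous (by fun_prop) (by fun_prop)]
    congr 1; ext x; ring
  have n1 : ∫ x in (0 : ℝ)..1, u x = 1 / 2 + H := by
    have e : ∀ x, u x = h x + (1 + (-1) * x + 0 * x ^ 2 + 0 * x ^ 3) := fun x => by
      rw [huh]; ring
    simp only [e]
    rw [integral_add_of_continuous hhc (by fun_prop), integral_cubic, ← hH]
    ring
  have n2 : ∫ x in (0 : ℝ)..1, x * u x = 1 / 6 + b := by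
    have e : ∀ x, x * u x = x * h x + (0 + 1 * x + (-1) * x ^ 2 + 0 * x ^ 3) := fun x => by
      rw [huh]; ring
    simp only [e]
    rw [integral_add_of_continuous (by fun_prop) (by fun_prop), integral_cubic, ← hb]
    ring
  have n3 : ∫ x in (0 : ℝ)..1, x ^ 2 * u x = 1 / 12 + c := by
    have e : ∀ x, x ^ 2 * u x = x ^ 2 * h x + (0 + 0 * x + 1 * x ^ 2 + (-1) * x ^ 3) :=
      fun x => by rw [huh]; ring
    simp only [e]
    rw [integral_add_of_continuous (by fun_prop) (by fun_prop), integral_cubic, ← hc]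
    ring
  have n4 : ∫ x in (0 : ℝ)..1, u x ^ 2 / 2 = 1 / 6 + (H - b) + P / 2 := by
    have e : ∀ x, u x ^ 2 / 2 = (h x - x * h x + 1 / 2 * h x ^ 2) +
        (1 / 2 + (-1) * x + 1 / 2 * x ^ 2 + 0 * x ^ 3) := fun x => by rw [huh]; ring
    simp only [e]
    rw [integral_add_of_continuous (by fun_prop) (by fun_prop), integral_cubic,
      integral_add_of_continuous (by fun_prop) (by fun_prop),
      integral_sub_of_continuous (by fun_prop) (by fun_prop),
      intervalIntegral.integral_const_mul, ← hH, ← hb, ← hP]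
    ring
  have n5 : ∫ x in (0 : ℝ)..1, x * (u x ^ 2 / 2) = (1 / 12 + 2 * (b - c) + V) / 2 := by
    have e : ∀ x, x * (u x ^ 2 / 2) = (x * h x - x ^ 2 * h x + 1 / 2 * (x * h x ^ 2)) +
        (0 + 1 / 2 * x + (-1) * x ^ 2 + 1 / 2 * x ^ 3) := fun x => by rw [huh]; ring
    simp only [e]
    rw [integral_add_of_continuous (by fun_prop) (by fun_prop), integral_cubic,
      integral_add_of_continuous (by fun_prop) (by fun_prop),
      integral_sub_of_continuous (by fun_prop) (by fun_prop),
      intervalIntegral.integral_const_mul, ← hb, ← hc, ← hV]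
    ring
  have n6 : ∫ x in (0 : ℝ)..1, u x ^ 3 / 3 =
      (1 / 4 + 3 * (H - 2 * b + c) + 3 * (P - V) + W) / 3 := by
    have e : ∀ x, u x ^ 3 / 3 = ((1 - x) ^ 2 * h x + (1 - x) * h x ^ 2 + 1 / 3 * h x ^ 3) +
        (1 / 3 + (-1) * x + 1 * x ^ 2 + (-1 / 3) * x ^ 3) := fun x => by rw [huh]; ring
    simp only [e]
    rw [integral_add_of_continuous (by fun_prop) (by fun_prop), integral_cubic,
      integral_add_of_continuous (by fun_prop) (by fun_prop),
      integral_add_of_continuous (by fun_prop) (by fun_prop),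
      intervalIntegral.integral_const_mul, m1, m3, ← hWd]
    ring
  rw [m1, m2, m3] at hU
  simp only [← hH, ← hb, ← hc, ← hP, ← hWd] at hB hE0 hE hW hHnn hHle
  rw [n1, n2, n3, n4, n5, n6]
  have hpoly := deficit_poly_nonpos hHnn hHle (b := b) (d := b - c) (by linarith) (by linarith)
    (hE (4 * H / 3) (by linarith) (by linarith))
  have hΦ : (c - b) + H / 6 + (P - V) / 2 - H / 2 * P + W / 3 - H ^ 2 / 3 + H ^ 3 / 3 ≤ 0 := by
    linarith
  have hA : 0 ≤ 1 / 2 + H := by linarith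
  have hmul := mul_nonpos_of_nonneg_of_nonpos hA hΦ
  have hsr : ∀ s r : ℝ, 0 ≤ s ^ 2 + r ^ 2 + s * r := fun s r => by
    linarith [sq_nonneg (s + r), sq_nonneg s, sq_nonneg r]
  have := hsr ((1 / 6 + b) - (1 + H) / 3 * (1 / 2 + H))
    ((1 / 6 + (H - b) + P / 2) - (1 + H) / 3 * (1 / 2 + H))
  linarith only [this, hmul]

lemma det_le_of_sum_le {p q r A : ℝ} (hp : 0 < p) (h : p + q + r ≤ A ^ 3 / 6) :
    108 * (p * q - r ^ 2) ≤ A ^ 6 := by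
  by_cases hd : p * q - r ^ 2 ≤ 0
  · have : 0 ≤ A ^ 6 := by positivity
    linarith
  push Not at hd
  have hq : 0 < q := pos_of_mul_pos_right (by nlinarith [sq_nonneg r]) hp.le
  have hS : 0 ≤ p + q + r := by
    have : |2 * r| ≤ p + q := abs_le_of_sq_le_sq (by nlinarith [sq_nonneg (p - q)]) (by linarith)
    have := neg_abs_le (2 * r)
    have := le_abs_self (2 * r)
    linarith
  have h2 : (p + q + r) ^ 2 ≤ (A ^ 3 / 6) ^ 2 := pow_le_pow_left₀ hS h 2
  nlinarith [sq_nonneg (p - q), sq_nonneg ((p + q) / 2 + 2 * r)]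

lemma covDet_le_of_antitone {M : ℝ} {f : ℝ → ℝ} (hM : 0 < M) (hf : Continuous f)
    (hc : ConcaveOn ℝ (Icc 0 M) f) (ha : AntitoneOn f (Icc 0 M)) (hf0 : ∀ x ∈ Icc 0 M, 0 ≤ f x)
    (hpos : 0 < f 0)
    (hcov : 0 < (∫ _ in graphRegion 0 M (fun _ => 0) f, (1 : ℝ)) *
      (∫ p in graphRegion 0 M (fun _ => 0) f, p.1 ^ 2) -
      (∫ p in graphRegion 0 M (fun _ => 0) f, p.1) ^ 2) :
    108 * covDet (graphRegion 0 M (fun _ => 0) f) ≤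
      (∫ _ in graphRegion 0 M (fun _ => 0) f, (1 : ℝ)) ^ 6 := by
  obtain ⟨u, hu⟩ : ∃ u : ℝ → ℝ, u = fun x => (f 0)⁻¹ * f (M * x) := ⟨_, rfl⟩
  have hfu : ∀ x, f (M * x) = f 0 * u x := fun x => by rw [hu]; field_simp
  have huc : Continuous u := by rw [hu]; fun_prop
  have hmem : ∀ x ∈ Icc (0 : ℝ) 1, M * x ∈ Icc 0 M := fun x hx =>
    ⟨mul_nonneg hM.le hx.1, mul_le_of_le_one_right hM.le hx.2⟩
  have hucc : ConcaveOn ℝ (Icc 0 1) u := by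
    refine ⟨convex_Icc 0 1, fun x hx y hy v w hv hw hvw => ?_⟩
    have := hc.2 (hmem x hx) (hmem y hy) hv hw hvw
    simp only [smul_eq_mul] at this ⊢
    rw [show v * (M * x) + w * (M * y) = M * (v * x + w * y) by ring] at this
    simp only [hfu] at this
    exact le_of_mul_le_mul_left (by linarith) hpos
  have hua : AntitoneOn u (Icc 0 1) := fun x hx y hy hxy => by
    have := ha (hmem x hx) (hmem y hy) (mul_le_mul_of_nonneg_left hxy hM.le)
    simp only [hfu] at this
    exact le_of_mul_le_mul_left this hpos
  have hu0 : u 0 = 1 := by rw [hu]; simp [hpos.ne']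
  have hu1 : 0 ≤ u 1 := by
    have := hf0 _ (hmem 1 (by simp))
    rw [hfu] at this
    exact nonneg_of_mul_nonneg_right this hpos
  have hmain := sum_moments_le huc hucc hua hu0 hu1
  have key : ∀ (φ : ℝ → ℝ), Continuous φ → ∀ n : ℕ,
      ∫ p in graphRegion 0 M (fun _ => 0) f, φ p.1 * p.2 ^ n =
        M * ∫ x in (0 : ℝ)..1, φ (M * x) * ((f 0 * u x) ^ (n + 1) / (n + 1)) := by
    intro φ hφ n
    rw [setIntegral_graphRegion_pow hM.le continuous_const hf hf0 hφ n]
    have := intervalIntegral.mul_integral_comp_mul_left (a := 0) (b := 1)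
      (f := fun x => φ x * ((f x ^ (n + 1) - 0 ^ (n + 1)) / (n + 1))) M
    simp only [mul_zero, mul_one] at this
    rw [← this]
    simp [hfu]
  set K := graphRegion 0 M (fun _ => 0) f
  have k1 : ∫ _ in K, (1 : ℝ) = M * f 0 * ∫ x in (0 : ℝ)..1, u x := by
    have := key (fun _ => 1) (by fun_prop) 0
    simp only [pow_zero, mul_one, one_mul, zero_add, pow_one, CharP.cast_eq_zero, div_one,
      intervalIntegral.integral_const_mul] at this
    rw [this]; ring
  have k2 : ∫ p in K, p.1 = M ^ 2 * f 0 * ∫ x in (0 : ℝ)..1, x * u x := by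
    have := key (fun x => x) (by fun_prop) 0
    simp only [pow_zero, mul_one, zero_add, pow_one, CharP.cast_eq_zero, div_one] at this
    rw [this, ← intervalIntegral.integral_const_mul, ← intervalIntegral.integral_const_mul]
    congr 1; ext x; ring
  have k3 : ∫ p in K, p.1 ^ 2 = M ^ 3 * f 0 * ∫ x in (0 : ℝ)..1, x ^ 2 * u x := by
    have := key (fun x => x ^ 2) (by fun_prop) 0
    simp only [pow_zero, mul_one, zero_add, pow_one, CharP.cast_eq_zero, div_one] at this
    rw [this, ← intervalIntegral.integral_const_mul, ← intervalIntegral.integral_const_mul]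
    congr 1; ext x; ring
  have k4 : ∫ p in K, p.2 = M * f 0 ^ 2 * ∫ x in (0 : ℝ)..1, u x ^ 2 / 2 := by
    have := key (fun _ => 1) (by fun_prop) 1
    norm_num only [pow_one, one_mul, Nat.cast_one] at this
    rw [this, ← intervalIntegral.integral_const_mul, ← intervalIntegral.integral_const_mul]
    congr 1; ext x; ring
  have k5 : ∫ p in K, p.1 * p.2 = M ^ 2 * f 0 ^ 2 * ∫ x in (0 : ℝ)..1, x * (u x ^ 2 / 2) := by
    have := key (fun x => x) (by fun_prop) 1
    norm_num only [pow_one, one_mul, Nat.cast_one] at this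
    rw [this, ← intervalIntegral.integral_const_mul, ← intervalIntegral.integral_const_mul]
    congr 1; ext x; ring
  have k6 : ∫ p in K, p.2 ^ 2 = M * f 0 ^ 3 * ∫ x in (0 : ℝ)..1, u x ^ 3 / 3 := by
    have := key (fun _ => 1) (by fun_prop) 2
    norm_num only [pow_one, one_mul, Nat.cast_ofNat] at this
    rw [this, ← intervalIntegral.integral_const_mul, ← intervalIntegral.integral_const_mul]
    congr 1; ext x; ring
  simp only [covDet, k1, k2, k3, k4, k5, k6] at hcov ⊢
  set A := ∫ x in (0 : ℝ)..1, u x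
  set X := ∫ x in (0 : ℝ)..1, x * u x
  set XX := ∫ x in (0 : ℝ)..1, x ^ 2 * u x
  set Y := ∫ x in (0 : ℝ)..1, u x ^ 2 / 2
  set XY := ∫ x in (0 : ℝ)..1, x * (u x ^ 2 / 2)
  set YY := ∫ x in (0 : ℝ)..1, u x ^ 3 / 3
  have hp : 0 < A * XX - X ^ 2 := by
    have e : M * f 0 * A * (M ^ 3 * f 0 * XX) - (M ^ 2 * f 0 * X) ^ 2 =
      (M ^ 4 * f 0 ^ 2) * (A * XX - X ^ 2) := by ring
    rw [e] at hcov
    exact pos_of_mul_pos_right hcov (by positivity)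
  have hfin := det_le_of_sum_le (q := A * YY - Y ^ 2) (r := A * XY - X * Y) (A := A) hp
    (by linarith)
  have := mul_le_mul_of_nonneg_left hfin (show 0 ≤ (M * f 0) ^ 6 by positivity)
  linarith

lemma isoC_eq {K : Set (ℝ × ℝ)} (hV : (∫ _ in K, (1 : ℝ)) ≠ 0) :
    isoC K = (∫ _ in K, (1 : ℝ)) ^ 6 / covDet K := by
  have hvol : (volume K).toReal = ∫ _ in K, (1 : ℝ) := by
    simp [Measure.real]
  have h00 : coord2 0 = fun p => p.1 := by ext p; simp [coord2]
  have h11 : coord2 1 = fun p => p.2 := by ext p; simp [coord2]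
  have hdet : (cov2 K).det = covDet K / (∫ _ in K, (1 : ℝ)) ^ 4 := by
    rw [Matrix.det_fin_two]
    simp only [cov2, bary2, Matrix.of_apply, hvol, h00, h11, covDet, ← pow_two]
    simp only [mul_comm (Prod.snd _)]
    field_simp
  rw [isoC, hdet, hvol]
  field_simp

lemma setIntegral_fst_slide {a b : ℝ} {g t : ℝ → ℝ} (hab : a ≤ b) (hg : Continuous g)
    (ht : Continuous t) (hgt : ∀ x ∈ Icc a b, g x ≤ t x) {φ : ℝ → ℝ} (hφ : Continuous φ) :
    ∫ p in graphRegion a b (fun _ => 0) (fun x => t x - g x), φ p.1 =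
      ∫ p in graphRegion a b g t, φ p.1 := by
  have h1 := setIntegral_graphRegion_pow hab hg ht hgt hφ 0
  have h2 := setIntegral_graphRegion_pow hab continuous_const (ht.sub hg)
    (fun x hx => sub_nonneg.mpr (hgt x hx)) hφ 0
  simp only [pow_zero, mul_one, zero_add, pow_one, CharP.cast_eq_zero, div_one, sub_zero] at h1 h2
  exact h2.trans h1.symm

lemma covDet_le {K : Set (ℝ × ℝ)} (hK : IsCompact K) (hc : Convex ℝ K)
    (hi : (interior K).Nonempty) : 108 * covDet K ≤ (∫ _ in K, (1 : ℝ)) ^ 6 := by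
  obtain ⟨hV, hA, hD⟩ := covDet_pos hK hi
  obtain ⟨a, b, g, t, hab, hg, ht, hgc, htc, hgt, rfl⟩ :=
    exists_eq_graphRegion hK hc (hi.mono interior_subset)
  have hslide := covDet_le_slide hab hg ht hgc htc hgt hV hA
  have e1 := setIntegral_fst_slide hab hg ht hgt (continuous_const (y := (1 : ℝ)))
  have e2 := setIntegral_fst_slide hab hg ht hgt continuous_id
  have e3 := setIntegral_fst_slide hab hg ht hgt (continuous_pow 2)
  simp only [id] at e2
  rw [← e1, ← e2, ← e3] at hA
  rw [← e1] at hV ⊢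
  have hD1 := hD.trans_le hslide
  refine (mul_le_mul_of_nonneg_left hslide (by norm_num)).trans ?_
  have hf0 : ∀ x ∈ Icc a b, 0 ≤ t x - g x := fun x hx => sub_nonneg.mpr (hgt x hx)
  obtain ⟨M, u, v, hM, hu, hv, huc, hvc, huv, hum, hva, -, -, he⟩ :=
    exists_slices (f := fun x => t x - g x) hab (ht.sub hg) (htc.sub hgc) hf0
  set K₁ := graphRegion a b (fun _ => 0) (fun x => t x - g x)
  have s1 := setIntegral_preimage_swap K₁ (fun _ => 1)
  have s2 := setIntegral_preimage_swap K₁ (fun p => p.2)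
  have s3 := setIntegral_preimage_swap K₁ (fun p => p.2 ^ 2)
  have s4 := covDet_preimage_swap K₁
  simp only [Prod.snd_swap] at s2 s3
  have hC : 0 < (∫ _ in K₁, (1 : ℝ)) * (∫ p in K₁, p.2 ^ 2) - (∫ p in K₁, p.2) ^ 2 := by
    refine pos_of_mul_pos_right ?_ hA.le
    have := hD1
    rw [covDet] at this
    linarith [sq_nonneg ((∫ _ in K₁, (1 : ℝ)) * (∫ p in K₁, p.1 * p.2) -
      (∫ p in K₁, p.1) * ∫ p in K₁, p.2)]
  rw [← s1] at hV
  rw [← s4] at hD1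
  rw [← s1, ← s2, ← s3] at hC
  rw [← s1, ← s4]
  rw [he] at hV hD1 hC ⊢
  have hslide' := covDet_le_slide hM hu hv huc hvc huv hV hC
  have e1 := setIntegral_fst_slide hM hu hv huv (continuous_const (y := (1 : ℝ)))
  have e2 := setIntegral_fst_slide hM hu hv huv continuous_id
  have e3 := setIntegral_fst_slide hM hu hv huv (continuous_pow 2)
  simp only [id] at e2
  rw [← e1, ← e2, ← e3] at hC
  refine (mul_le_mul_of_nonneg_left hslide' (by norm_num)).trans ?_
  have hV' : ∫ x in (0 : ℝ)..M, (v x - u x) = ∫ _ in graphRegion 0 M u v, (1 : ℝ) := by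
    have := setIntegral_graphRegion_pow hM hu hv huv (continuous_const (y := (1 : ℝ))) 0
    simp only [pow_zero, mul_one, one_mul, zero_add, pow_one, CharP.cast_eq_zero, div_one] at this
    exact this.symm
  have hanti : AntitoneOn (fun x => v x - u x) (Icc 0 M) := fun x hx y hy hxy =>
    sub_le_sub (hva hx hy hxy) (hum hx hy hxy)
  rw [← hV'] at hV
  have hMpos : 0 < M := by
    refine hM.lt_of_ne fun h => ?_
    rw [← h, intervalIntegral.integral_same] at hV
    exact lt_irrefl _ hV
  have hpos : 0 < v 0 - u 0 := by
    by_contra! hcon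
    have := integral_nonpos_of_le hM (φ := fun x => v x - u x) fun x hx =>
      (hanti (left_mem_Icc.mpr hM) hx hx.1).trans hcon
    linarith
  rw [← e1]
  exact covDet_le_of_antitone hMpos (hv.sub hu) (hvc.sub huc) hanti
    (fun x hx => sub_nonneg.mpr (huv x hx)) hpos hC

lemma simplexTwo_eq_graphRegion :
    simplexTwo = graphRegion (-1) 1 (fun x => (x - 1) / 2) (fun x => min (2 * x + 1) (1 - x)) := by
  apply subset_antisymm
  · refine convexHull_min ?_ (convex_graphRegion ?_ ?_)
    · rintro p (rfl | rfl | rfl) <;> norm_num [graphRegion]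
    · convert convexOn_affine (convex_Icc (-1 : ℝ) 1) (1 / 2) (-1 / 2) using 2
      ring
    · have h1 : ConcaveOn ℝ (Icc (-1 : ℝ) 1) fun x => 2 * x + 1 :=
        ⟨convex_Icc _ _, fun x _ y _ c d _ _ hcd => by simp only [smul_eq_mul]; linarith⟩
      have h2 : ConcaveOn ℝ (Icc (-1 : ℝ) 1) fun x => 1 - x :=
        ⟨convex_Icc _ _, fun x _ y _ c d _ _ hcd => by simp only [smul_eq_mul]; linarith⟩
      exact h1.inf h2
  · rintro ⟨x, y⟩ ⟨-, h1, h2⟩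
    simp only [le_min_iff] at h1 h2
    have hmem : ∀ p ∈ ({((1 : ℝ), (0 : ℝ)), ((0 : ℝ), (1 : ℝ)), ((-1 : ℝ), (-1 : ℝ))} :
        Set (ℝ × ℝ)), p ∈ simplexTwo := fun p hp => subset_convexHull ℝ _ hp
    have := (convex_convexHull ℝ _ : Convex ℝ simplexTwo).sum_mem
      (t := Finset.univ) (w := ![x + (1 - x - y) / 3, y + (1 - x - y) / 3, (1 - x - y) / 3])
      (z := ![((1 : ℝ), (0 : ℝ)), ((0 : ℝ), (1 : ℝ)), ((-1 : ℝ), (-1 : ℝ))])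
      (by
        intro i _
        fin_cases i <;> simp <;> linarith)
      (by
        simp [Fin.sum_univ_three]
        ring)
      (by
        intro i _
        fin_cases i <;> exact hmem _ (by simp))
    rw [Fin.sum_univ_three] at this
    refine mem_of_eq_of_mem (Prod.ext ?_ ?_) this <;> simp

lemma integral_simplexTwo {φ : ℝ → ℝ} (hφ : Continuous φ) (n : ℕ) :
    ∫ p in simplexTwo, φ p.1 * p.2 ^ n =
      (∫ x in (-1 : ℝ)..0, φ x * (((2 * x + 1) ^ (n + 1) - ((x - 1) / 2) ^ (n + 1)) / (n + 1))) +
      ∫ x in (0 : ℝ)..1, φ x * (((1 - x) ^ (n + 1) - ((x - 1) / 2) ^ (n + 1)) / (n + 1)) := by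
  rw [simplexTwo_eq_graphRegion, setIntegral_graphRegion_pow (by norm_num) (by fun_prop)
    (by fun_prop) (fun x hx => le_min (by linarith [hx.1]) (by linarith [hx.2])) hφ n]
  have hcont : Continuous fun x : ℝ => φ x *
      ((min (2 * x + 1) (1 - x) ^ (n + 1) - ((x - 1) / 2) ^ (n + 1)) / (n + 1)) := by fun_prop
  rw [← intervalIntegral.integral_add_adjacent_intervals (hcont.intervalIntegrable (-1) 0)
    (hcont.intervalIntegrable 0 1)]
  congr 1
  · refine intervalIntegral.integral_congr fun x hx => ?_
    rw [uIcc_of_le (by norm_num)] at hx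
    rw [min_eq_left (by linarith [hx.2])]
  · refine intervalIntegral.integral_congr fun x hx => ?_
    rw [uIcc_of_le (by norm_num)] at hx
    rw [min_eq_right (by linarith [hx.1])]

lemma integral_eq_of_cubic {a b : ℝ} {φ : ℝ → ℝ} (c₀ c₁ c₂ c₃ : ℝ)
    (h : ∀ x, φ x = c₀ + c₁ * x + c₂ * x ^ 2 + c₃ * x ^ 3) :
    ∫ x in a..b, φ x = c₀ * (b - a) + c₁ * ((b ^ 2 - a ^ 2) / 2) + c₂ * ((b ^ 3 - a ^ 3) / 3) +
        c₃ * ((b ^ 4 - a ^ 4) / 4) := by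
  simp only [h, integral_cubic]

lemma isoC_simplexTwo : isoC simplexTwo = 108 := by
  have k1 := integral_simplexTwo (continuous_const (y := (1 : ℝ))) 0
  have k2 := integral_simplexTwo continuous_id 0
  have k3 := integral_simplexTwo (continuous_pow 2) 0
  have k4 := integral_simplexTwo (continuous_const (y := (1 : ℝ))) 1
  have k5 := integral_simplexTwo continuous_id 1
  have k6 := integral_simplexTwo (continuous_const (y := (1 : ℝ))) 2
  simp only [id, zero_add, pow_zero, mul_one, one_mul, pow_one, CharP.cast_eq_zero, div_one,
    Nat.cast_one, Nat.cast_ofNat] at k1 k2 k3 k4 k5 k6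
  rw [integral_eq_of_cubic (3 / 2) (3 / 2) 0 0 (fun x => by ring),
    integral_eq_of_cubic (3 / 2) (-3 / 2) 0 0 (fun x => by ring)] at k1
  rw [integral_eq_of_cubic 0 (3 / 2) (3 / 2) 0 (fun x => by ring),
    integral_eq_of_cubic 0 (3 / 2) (-3 / 2) 0 (fun x => by ring)] at k2
  rw [integral_eq_of_cubic 0 0 (3 / 2) (3 / 2) (fun x => by ring),
    integral_eq_of_cubic 0 0 (3 / 2) (-3 / 2) (fun x => by ring)] at k3
  rw [integral_eq_of_cubic (3 / 8) (9 / 4) (15 / 8) 0 (fun x => by ring),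
    integral_eq_of_cubic (3 / 8) (-3 / 4) (3 / 8) 0 (fun x => by ring)] at k4
  rw [integral_eq_of_cubic 0 (3 / 8) (9 / 4) (15 / 8) (fun x => by ring),
    integral_eq_of_cubic 0 (3 / 8) (-3 / 4) (3 / 8) (fun x => by ring)] at k5
  rw [integral_eq_of_cubic (3 / 8) (15 / 8) (33 / 8) (21 / 8) (fun x => by ring),
    integral_eq_of_cubic (3 / 8) (-9 / 8) (9 / 8) (-3 / 8) (fun x => by ring)] at k6
  have hV : ∫ _ in simplexTwo, (1 : ℝ) = 3 / 2 := by rw [k1]; norm_num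
  rw [isoC_eq (by rw [hV]; norm_num), covDet, k1, k2, k3, k4, k5, k6]
  norm_num

/-- Theorem 1.13, strong slicing conjecture in the plane:
every convex body `K ⊆ ℝ²` satisfies `C(K) ≥ 108`, with `C(Δ_{2,0}) = 108`. -/
theorem strong_slicing_two_dim :
    (∀ K : Set (ℝ × ℝ), IsCompact K → Convex ℝ K → (interior K).Nonempty →
      (108 : ℝ) ≤ isoC K) ∧ isoC simplexTwo = 108 := by
  refine ⟨fun K hK hc hi => ?_, isoC_simplexTwo⟩
  obtain ⟨hV, -, hD⟩ := covDet_pos hK hi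
  rw [isoC_eq hV.ne', le_div_iff₀ hD]
  exact covDet_le hK hc hi
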